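/- Let N ≥ 1, 0 < γ < min{2,N}, p = p_γ := 1 + (2−γ)/N, 0 < T < ∞ and z ∈ ℝ^N (z = 0 allowed). There exist constants c* > 0 and C* > 0 depending only on N, p, γ (and not on T or z) with the following property: if u₀ is a nonnegative measurable function on ℝ^N satisfying u₀(x) ≤ c |x−z|^{−N} (log(e+|x−z|^{−1}))^{−N/(2−γ)−1} χ₁(|x−z|) + C₀ for all x ∈ ℝ^N \ {z}, where 0 < c ≤ c* (1 + T^{1/2})^{−1/(p−1)} and 0 ≤ C₀ ≤ C* T^{−(2−γ)/(2(p−1))}, then the Hardy parabolic equation ∂_t u − Δu = |x|^{−γ} u^p with initial data u₀ possesses a solution on ℝ^N × [0,T). -/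

import Mathlib

open MeasureTheory Real Set

noncomputable def heatKernel (N : ℕ) (x : EuclideanSpace ℝ (Fin N)) (t : ℝ) : ℝ :=
  (4 * Real.pi * t) ^ (-(N : ℝ) / 2) * Real.exp (-‖x‖ ^ 2 / (4 * t))

/-- `u` is a (nonnegative, integral) solution of `∂_t u - Δu = |x|^{-γ} u^p`
with initial data the nonnegative measurable function `u₀`, on `ℝ^N × [0,T)`. -/
def IsSol (N : ℕ) (γ p T : ℝ) (u₀ : EuclideanSpace ℝ (Fin N) → ℝ)
    (u : EuclideanSpace ℝ (Fin N) → ℝ → ℝ) : Prop :=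
  Measurable (Function.uncurry u) ∧ (∀ x t, 0 ≤ u x t) ∧
    ∀ᵐ q : EuclideanSpace ℝ (Fin N) × ℝ,
      q.2 ∈ Set.Ioo 0 T →
        u q.1 q.2 = (∫ y, heatKernel N (q.1 - y) q.2 * u₀ y) +
          ∫ s in Set.Ioo 0 q.2, ∫ y,
            heatKernel N (q.1 - y) (q.2 - s) * ‖y‖ ^ (-γ) * u y s ^ p

/-- The shifted logarithm `log (e + x)`. -/
noncomputable def expLog (x : ℝ) : ℝ := Real.log (Real.exp 1 + x)

lemma one_le_expLog {x : ℝ} (hx : 0 ≤ x) : 1 ≤ expLog x := by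
  rw [expLog, Real.le_log_iff_exp_le (by positivity)]
  linarith

lemma expLog_pos {x : ℝ} (hx : 0 ≤ x) : 0 < expLog x :=
  lt_of_lt_of_le one_pos (one_le_expLog hx)

lemma expLog_le_expLog {x y : ℝ} (hx : 0 ≤ x) (hxy : x ≤ y) : expLog x ≤ expLog y :=
  Real.log_le_log (by positivity) (by linarith)

lemma measurable_expLog : Measurable expLog :=
  Real.measurable_log.comp (measurable_const.add measurable_id)

lemma expLog_mul_le {l x : ℝ} (hl : 0 ≤ l) (hx : 0 ≤ x) :
    expLog (l * x) ≤ (1 + Real.log (1 + l)) * expLog x := by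
  have he : 0 < Real.exp 1 := Real.exp_pos 1
  have h1 : Real.exp 1 + l * x ≤ (1 + l) * (Real.exp 1 + x) := by nlinarith [mul_nonneg hl he.le]
  have h2 : expLog (l * x) ≤ Real.log (1 + l) + expLog x := by
    rw [expLog, expLog, ← Real.log_mul (by positivity) (by positivity)]
    exact Real.log_le_log (by positivity) h1
  have h3 : 0 ≤ Real.log (1 + l) := Real.log_nonneg (by linarith)
  nlinarith [one_le_expLog hx]

lemma expLog_rpow_le {d x : ℝ} (hd : 0 < d) (hx : 0 ≤ x) :
    expLog (x ^ d) ≤ (d + 2) * expLog x := by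
  have he : 2 ≤ Real.exp 1 := by linarith [Real.add_one_le_exp (1 : ℝ)]
  have h0 : 1 ≤ (Real.exp 1 + x) ^ d := Real.one_le_rpow (by linarith) hd.le
  have h1 : x ^ d ≤ (Real.exp 1 + x) ^ d := Real.rpow_le_rpow hx (by linarith) hd.le
  have h2 : Real.exp 1 + x ^ d ≤ Real.exp 1 ^ (2 : ℝ) * (Real.exp 1 + x) ^ d := by
    have h4 : Real.exp 1 ^ (2 : ℝ) ≥ Real.exp 1 + Real.exp 1 := by rw [Real.rpow_two]; nlinarith
    nlinarith [mul_le_mul_of_nonneg_right h4 (zero_le_one.trans h0),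
      mul_nonneg (by linarith : 0 ≤ Real.exp 1) (sub_nonneg.2 h0),
      mul_nonneg (by linarith : 0 ≤ Real.exp 1 - 1) (zero_le_one.trans h0)]
  have h3 : expLog (x ^ d) ≤ 2 + d * expLog x := by
    have := Real.log_le_log (by positivity) h2
    rwa [Real.log_mul (by positivity) (by positivity), Real.log_rpow (by positivity),
      Real.log_rpow (by positivity), Real.log_exp, mul_one] at this
  nlinarith [one_le_expLog hx]

lemma exists_one_add_log_rpow_le {a m : ℝ} (ha : 0 < a) (hm : 0 < m) :
    ∃ C : ℝ, 0 < C ∧ ∀ l : ℝ, 0 ≤ l → (1 + Real.log (1 + l)) ^ m ≤ C * (1 + l) ^ a := by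
  have hd : 0 < a / m := div_pos ha hm
  refine ⟨(1 + (a / m)⁻¹) ^ m, by positivity, fun l hl => ?_⟩
  have h1 := Real.log_le_rpow_div (x := 1 + l) (by linarith) hd
  have h2 : 1 ≤ (1 + l) ^ (a / m) := Real.one_le_rpow (by linarith) hd.le
  have h3 : 0 ≤ Real.log (1 + l) := Real.log_nonneg (by linarith)
  calc (1 + Real.log (1 + l)) ^ m ≤ ((1 + (a / m)⁻¹) * (1 + l) ^ (a / m)) ^ m := by
        apply Real.rpow_le_rpow (by linarith) _ hm.le
        rw [div_eq_mul_inv] at h1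
        linarith
    _ = (1 + (a / m)⁻¹) ^ m * (1 + l) ^ a := by
        rw [Real.mul_rpow (by positivity) (by positivity), ← Real.rpow_mul (by linarith),
          div_mul_cancel₀ _ hm.ne']

/-- `x ^ a * log (e + x) ^ (-m)` is nondecreasing up to a multiplicative constant. -/
lemma exists_rpow_mul_expLog_le {a m : ℝ} (ha : 0 < a) (hm : 0 < m) :
    ∃ C : ℝ, 0 < C ∧ ∀ x y : ℝ, 0 ≤ x → x ≤ y →
      x ^ a * expLog x ^ (-m) ≤ C * (y ^ a * expLog y ^ (-m)) := by
  obtain ⟨C, hC, h⟩ := exists_one_add_log_rpow_le ha hm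
  refine ⟨C * 2 ^ a, by positivity, fun x y hx hxy => ?_⟩
  rcases hx.eq_or_lt with rfl | hx
  · rw [Real.zero_rpow ha.ne', zero_mul]
    have := expLog_pos hxy
    positivity
  have hy : 0 < y := hx.trans_le hxy
  have hl : 1 ≤ y / x := (one_le_div hx).2 hxy
  have hEx := expLog_pos hx.le
  have hEy := expLog_pos hy.le
  have hlog : 0 ≤ Real.log (1 + y / x) := Real.log_nonneg (by linarith)
  have h1 : expLog y ≤ (1 + Real.log (1 + y / x)) * expLog x := by
    have := expLog_mul_le (l := y / x) (by positivity) hx.le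
    rwa [div_mul_cancel₀ _ hx.ne'] at this
  have h2 : expLog y ^ m ≤ C * (2 ^ a * (y / x) ^ a) * expLog x ^ m := by
    calc expLog y ^ m ≤ ((1 + Real.log (1 + y / x)) * expLog x) ^ m :=
          Real.rpow_le_rpow hEy.le h1 hm.le
      _ = (1 + Real.log (1 + y / x)) ^ m * expLog x ^ m :=
          Real.mul_rpow (by linarith) hEx.le
      _ ≤ (C * (1 + y / x) ^ a) * expLog x ^ m := by
          gcongr
          exact h _ (by positivity)
      _ ≤ C * (2 ^ a * (y / x) ^ a) * expLog x ^ m := by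
          rw [← Real.mul_rpow (by norm_num) (by positivity)]
          gcongr
          linarith
  rw [Real.rpow_neg hEx.le, Real.rpow_neg hEy.le, ← div_eq_mul_inv, ← div_eq_mul_inv,
    ← mul_div_assoc, div_le_div_iff₀ (by positivity) (by positivity)]
  rw [Real.div_rpow hy.le hx.le] at h2
  have hxa : 0 < x ^ a := by positivity
  calc x ^ a * expLog y ^ m ≤ x ^ a * (C * (2 ^ a * (y ^ a / x ^ a)) * expLog x ^ m) := by gcongr
    _ = C * 2 ^ a * y ^ a * expLog x ^ m := by field_simp

lemma hasDerivAt_expLog_div_rpow {T b s : ℝ} (hT : 0 < T) (hs : 0 < s) :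
    HasDerivAt (fun r => expLog (T / r) ^ (-b))
      (b * (T / (s * (Real.exp 1 * s + T))) * expLog (T / s) ^ (-(1 + b))) s := by
  have he : 0 < Real.exp 1 := Real.exp_pos 1
  have h1 : HasDerivAt (fun r : ℝ => Real.exp 1 + T / r) (-(T / s ^ 2)) s := by
    have := ((hasDerivAt_inv hs.ne').const_mul T).const_add (Real.exp 1)
    refine this.congr_deriv ?_
    ring
  have h2 := (h1.log (by positivity)).rpow_const (p := -b)
    (Or.inl (expLog_pos (x := T / s) (by positivity)).ne')
  refine h2.congr_deriv ?_
  rw [show -b - 1 = -(1 + b) by ring]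
  change _ * expLog (T / s) ^ _ = _
  field_simp

lemma lintegral_inv_mul_expLog_le {T b r : ℝ} (hb : 0 < b) (hr : 0 < r) (hrT : r ≤ T) :
    ∫⁻ s in Ioo 0 r, ENNReal.ofReal (s⁻¹ * expLog (T / s) ^ (-(1 + b))) ≤
      ENNReal.ofReal ((1 + Real.exp 1) / b * expLog (T / r) ^ (-b)) := by
  have hT : 0 < T := hr.trans_le hrT
  have he : 0 < Real.exp 1 := Real.exp_pos 1
  set g' : ℝ → ℝ := fun s => b * (T / (s * (Real.exp 1 * s + T))) * expLog (T / s) ^ (-(1 + b))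
    with hg'
  set g : ℝ → ℝ := fun s => if s ≤ 0 then 0 else expLog (T / s) ^ (-b) with hg
  have hg_pos : ∀ s, 0 < s → g s = expLog (T / s) ^ (-b) := fun s hs => by
    simp [hg, hs]
  have hderiv : ∀ s, 0 < s → HasDerivAt g (g' s) s := fun s hs => by
    refine (hasDerivAt_expLog_div_rpow hT hs).congr_of_eventuallyEq ?_
    filter_upwards [lt_mem_nhds hs] with y hy using hg_pos y hy
  have hcont : ContinuousOn g (Icc 0 r) := by
    intro s hs
    rcases hs.1.eq_or_lt with rfl | hs0
    · have h0 : Filter.Tendsto (fun s : ℝ => expLog (T / s) ^ (-b)) (nhdsWithin 0 (Ioi 0))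
          (nhds 0) := by
        refine (tendsto_rpow_neg_atTop hb).comp (Real.tendsto_log_atTop.comp ?_)
        refine Filter.tendsto_atTop_add_const_left _ _ ?_
        change Filter.Tendsto (fun s => T / s) _ _
        simp only [div_eq_mul_inv]
        exact tendsto_inv_nhdsGT_zero.const_mul_atTop hT
      have h1 : ContinuousWithinAt g (Ioi 0) 0 := by
        rw [ContinuousWithinAt, show g 0 = 0 by simp [hg]]
        refine h0.congr' ?_
        filter_upwards [self_mem_nhdsWithin] with y hy using (hg_pos y hy).symm
      have h2 : ContinuousWithinAt g (Ici 0) 0 := by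
        rw [← Ioi_insert]
        exact h1.insert
      exact h2.mono Icc_subset_Ici_self
    · exact (hderiv s hs0).continuousAt.continuousWithinAt
  have hg'0 : ∀ s ∈ Ioo 0 r, 0 ≤ g' s := fun s hs => by
    have := expLog_pos (x := T / s) (div_nonneg hT.le hs.1.le)
    have := hs.1
    simp only [hg']
    positivity
  have hint : IntegrableOn g' (Ioc 0 r) :=
    intervalIntegral.integrableOn_deriv_of_nonneg hcont (fun s hs => hderiv s hs.1) hg'0
  have hval : ∫ s in Ioo 0 r, g' s = expLog (T / r) ^ (-b) := by
    rw [← integral_Ioc_eq_integral_Ioo, ← intervalIntegral.integral_of_le hr.le,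
      intervalIntegral.integral_eq_sub_of_hasDerivAt_of_le hr.le hcont
        (fun s hs => hderiv s hs.1)
        ((intervalIntegrable_iff_integrableOn_Ioc_of_le hr.le).2 hint), hg_pos r hr]
    simp [hg]
  have hle : ∀ s ∈ Ioo 0 r, ENNReal.ofReal (s⁻¹ * expLog (T / s) ^ (-(1 + b))) ≤
      ENNReal.ofReal ((1 + Real.exp 1) / b) * ENNReal.ofReal (g' s) := fun s hs => by
    have hE := expLog_pos (x := T / s) (div_nonneg hT.le hs.1.le)
    have hs0 := hs.1
    rw [← ENNReal.ofReal_mul (by positivity)]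
    apply ENNReal.ofReal_le_ofReal
    simp only [hg']
    rw [← mul_assoc, ← mul_assoc]
    gcongr
    rw [div_mul_cancel₀ _ hb.ne', ← mul_div_assoc, inv_eq_one_div,
      div_le_div_iff₀ hs0 (by positivity)]
    nlinarith [mul_pos hs0 he, hs.2]
  calc _ ≤ ∫⁻ s in Ioo 0 r, ENNReal.ofReal ((1 + Real.exp 1) / b) * ENNReal.ofReal (g' s) :=
        setLIntegral_mono' measurableSet_Ioo hle
    _ = ENNReal.ofReal ((1 + Real.exp 1) / b) * ENNReal.ofReal (∫ s in Ioo 0 r, g' s) := by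
        rw [lintegral_const_mul' _ _ ENNReal.ofReal_ne_top,
          ofReal_integral_eq_lintegral_ofReal (hint.mono_set Ioo_subset_Ioc_self)
            ((ae_restrict_iff' measurableSet_Ioo).2 (Filter.Eventually.of_forall hg'0))]
    _ = _ := by rw [hval, ← ENNReal.ofReal_mul (by positivity)]

lemma lintegral_Ioo_rpow {a r : ℝ} (ha : -1 < a) (hr : 0 < r) :
    ∫⁻ s in Ioo 0 r, ENNReal.ofReal (s ^ a) = ENNReal.ofReal (r ^ (a + 1) / (a + 1)) := by
  have hint := (intervalIntegral.intervalIntegrable_rpow' ha (a := 0) (b := r))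
  rw [intervalIntegrable_iff_integrableOn_Ioc_of_le hr.le] at hint
  rw [← ofReal_integral_eq_lintegral_ofReal (hint.mono_set Ioo_subset_Ioc_self)
    ((ae_restrict_iff' measurableSet_Ioo).2
      (Filter.Eventually.of_forall fun s hs => Real.rpow_nonneg hs.1.le _)),
    ← integral_Ioc_eq_integral_Ioo, ← intervalIntegral.integral_of_le hr.le,
    integral_rpow (Or.inl ha), Real.zero_rpow (by linarith), sub_zero]

lemma lintegral_Ioo_one_sub_div_rpow {a t : ℝ} (ha : -1 < a) (ht : 0 < t) :
    ∫⁻ s in Ioo 0 t, ENNReal.ofReal ((1 - s / t) ^ a) = ENNReal.ofReal (t / (a + 1)) := by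
  have h1 : ∫⁻ s in Ioo 0 t, ENNReal.ofReal ((1 - s / t) ^ a) =
      ∫⁻ s in Ioo 0 t, ENNReal.ofReal ((s / t) ^ a) := by
    rw [← lintegral_indicator measurableSet_Ioo, ← lintegral_indicator measurableSet_Ioo,
      ← lintegral_sub_left_eq_self _ t]
    congr with s
    have h3 : t - s ∈ Ioo 0 t ↔ s ∈ Ioo 0 t := by
      constructor <;> rintro ⟨_, _⟩ <;> constructor <;> linarith
    have h4 : 1 - (t - s) / t = s / t := by
      field_simp
      ring
    by_cases h : s ∈ Ioo 0 t
    · rw [indicator_of_mem h, indicator_of_mem (h3.2 h), h4]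
    · rw [indicator_of_notMem h, indicator_of_notMem (h3.not.2 h)]
  have h2 : ∀ s ∈ Ioo 0 t, ENNReal.ofReal ((s / t) ^ a) =
      ENNReal.ofReal ((t ^ a)⁻¹) * ENNReal.ofReal (s ^ a) := fun s hs => by
    rw [← ENNReal.ofReal_mul (by positivity), Real.div_rpow hs.1.le ht.le, div_eq_inv_mul]
  rw [h1, setLIntegral_congr_fun measurableSet_Ioo h2,
    lintegral_const_mul' _ _ ENNReal.ofReal_ne_top, lintegral_Ioo_rpow ha ht,
    ← ENNReal.ofReal_mul (by positivity), Real.rpow_add ht, Real.rpow_one]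
  congr 1
  field_simp

/-- Integration of radial functions in polar coordinates. -/
lemma lintegral_fun_norm {F : Type*} [NormedAddCommGroup F] [NormedSpace ℝ F] [Nontrivial F]
    [MeasurableSpace F] [BorelSpace F] [FiniteDimensional ℝ F] (μ : Measure F)
    [μ.IsAddHaarMeasure] {f : ℝ → ENNReal} (hf : Measurable f) :
    ∫⁻ x, f ‖x‖ ∂μ = μ.toSphere univ *
      ∫⁻ y in Ioi (0 : ℝ), ENNReal.ofReal (y ^ (Module.finrank ℝ F - 1)) * f y := by
  have hm : Measurable fun x : ↥(Ioi (0 : ℝ)) => f x := hf.comp measurable_subtype_coe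
  have hm2 : Measurable fun x : ↥(Metric.sphere (0 : F) 1) × ↥(Ioi (0 : ℝ)) => f x.2 :=
    hm.comp measurable_snd
  calc ∫⁻ x, f ‖x‖ ∂μ = ∫⁻ x : ({(0)}ᶜ : Set F), f ‖x.1‖ ∂(μ.comap (↑)) := by
        rw [lintegral_subtype_comap (measurableSet_singleton _).compl fun x => f ‖x‖,
          restrict_compl_singleton]
    _ = ∫⁻ x, f x.2 ∂μ.toSphere.prod (.volumeIoiPow (Module.finrank ℝ F - 1)) := by
        rw [← μ.measurePreserving_homeomorphUnitSphereProd.lintegral_comp hm2]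
        simp
    _ = μ.toSphere univ * ∫⁻ x : Ioi (0 : ℝ), f x ∂.volumeIoiPow (Module.finrank ℝ F - 1) := by
        rw [lintegral_prod _ hm2.aemeasurable]
        simp [mul_comm]
    _ = _ := by
        rw [Measure.volumeIoiPow, lintegral_withDensity_eq_lintegral_mul _ (by fun_prop) hm]
        simp only [Pi.mul_apply]
        rw [lintegral_subtype_comap measurableSet_Ioi
          fun y => ENNReal.ofReal (y ^ (Module.finrank ℝ F - 1)) * f y]

lemma heatKernel_nonneg (N : ℕ) (x : EuclideanSpace ℝ (Fin N)) {t : ℝ} (ht : 0 ≤ t) :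
    0 ≤ heatKernel N x t := by
  unfold heatKernel
  positivity

lemma heatKernel_le (N : ℕ) (x : EuclideanSpace ℝ (Fin N)) {t : ℝ} (ht : 0 ≤ t) :
    heatKernel N x t ≤ (4 * Real.pi * t) ^ (-(N : ℝ) / 2) := by
  unfold heatKernel
  refine mul_le_of_le_one_right (by positivity) (Real.exp_le_one_iff.2 ?_)
  rw [neg_div, neg_nonpos]
  positivity

lemma measurable_heatKernel (N : ℕ) :
    Measurable fun q : EuclideanSpace ℝ (Fin N) × ℝ => heatKernel N q.1 q.2 := by
  unfold heatKernel
  fun_prop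

lemma measurable_heatKernel_comp {N : ℕ} {Y : Type*} [MeasurableSpace Y]
    {f : Y → EuclideanSpace ℝ (Fin N)} {g : Y → ℝ} (hf : Measurable f) (hg : Measurable g) :
    Measurable fun y => heatKernel N (f y) (g y) :=
  (measurable_heatKernel N).comp (hf.prodMk hg)

lemma integral_heatKernel (N : ℕ) {t : ℝ} (ht : 0 < t) : ∫ y, heatKernel N y t = 1 := by
  have h := GaussianFourier.integral_rexp_neg_mul_sq_norm (V := EuclideanSpace ℝ (Fin N))
    (b := 1 / (4 * t)) (by positivity)
  simp only [heatKernel]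
  rw [integral_const_mul]
  have h2 : ∀ v : EuclideanSpace ℝ (Fin N),
      -‖v‖ ^ 2 / (4 * t) = -(1 / (4 * t)) * ‖v‖ ^ 2 := fun v => by ring
  simp only [h2]
  rw [h, finrank_euclideanSpace_fin, show Real.pi / (1 / (4 * t)) = 4 * Real.pi * t by field_simp,
    ← Real.rpow_add (by positivity)]
  ring_nf
  exact Real.rpow_zero _

lemma lintegral_heatKernel (N : ℕ) (x : EuclideanSpace ℝ (Fin N)) {t : ℝ} (ht : 0 < t) :
    ∫⁻ y, ENNReal.ofReal (heatKernel N (x - y) t) = 1 := by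
  rw [lintegral_sub_left_eq_self (fun y => ENNReal.ofReal (heatKernel N y t)) x,
    ← ofReal_integral_eq_lintegral_ofReal, integral_heatKernel N ht, ENNReal.ofReal_one]
  · by_contra h
    have := integral_heatKernel N ht
    rw [integral_undef h] at this
    exact zero_ne_one this
  · exact Filter.Eventually.of_forall fun y => heatKernel_nonneg N y ht.le

/-- Product of two Gaussians as a Gaussian in the outer variable times one around the
barycentre. -/
lemma heatKernel_mul_heatKernel (N : ℕ) (x y w : EuclideanSpace ℝ (Fin N)) {s t : ℝ} (hs : 0 < s)
    (hst : s < t) :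
    heatKernel N (x - y) (t - s) * heatKernel N (y - w) s =
      heatKernel N (x - w) t *
        heatKernel N (((s / t) • x + ((t - s) / t) • w) - y) (s * (t - s) / t) := by
  have ht : 0 < t := hs.trans hst
  have hts : 0 < t - s := sub_pos.2 hst
  have h1 : ‖x - y‖ ^ 2 / (t - s) + ‖y - w‖ ^ 2 / s = ‖x - w‖ ^ 2 / t +
      ‖((s / t) • x + ((t - s) / t) • w) - y‖ ^ 2 / (s * (t - s) / t) := by
    set a := x - y with ha
    set b := y - w with hb
    have e1 : x - w = a + b := by rw [ha, hb]; abel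
    have e2 : ((s / t) • x + ((t - s) / t) • w) - y = (s / t) • a - ((t - s) / t) • b := by
      have : y = (s / t) • y + ((t - s) / t) • y := by
        rw [← add_smul, ← add_div, add_sub_cancel, div_self ht.ne', one_smul]
      rw [ha, hb, smul_sub, smul_sub]
      nth_rewrite 1 [this]
      abel
    rw [e1, e2]
    clear_value a b
    rw [norm_add_sq_real, norm_sub_sq_real, inner_smul_left, inner_smul_right, norm_smul,
      norm_smul, Real.norm_of_nonneg (by positivity), Real.norm_of_nonneg (by positivity)]
    simp only [conj_trivial]
    field_simp
    ring
  have h2 : Real.exp (-‖x - y‖ ^ 2 / (4 * (t - s))) * Real.exp (-‖y - w‖ ^ 2 / (4 * s)) =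
      Real.exp (-‖x - w‖ ^ 2 / (4 * t)) *
        Real.exp (-‖((s / t) • x + ((t - s) / t) • w) - y‖ ^ 2 / (4 * (s * (t - s) / t))) := by
    rw [← Real.exp_add, ← Real.exp_add]
    congr 1
    have e : ∀ u v : ℝ, -u / (4 * v) = -(u / v) / 4 := fun u v => by
      rw [mul_comm, ← div_div, neg_div]
    rw [e, e, e, e]
    linarith
  have h3 : (4 * Real.pi * (t - s)) ^ (-(N : ℝ) / 2) * (4 * Real.pi * s) ^ (-(N : ℝ) / 2) =
      (4 * Real.pi * t) ^ (-(N : ℝ) / 2) * (4 * Real.pi * (s * (t - s) / t)) ^ (-(N : ℝ) / 2) := by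
    rw [← Real.mul_rpow (by positivity) (by positivity),
      ← Real.mul_rpow (by positivity) (by positivity)]
    congr 1
    field_simp
  unfold heatKernel
  rw [mul_mul_mul_comm, h3, h2, mul_mul_mul_comm]

lemma lintegral_ball_fun_norm {N : ℕ} (hN : 1 ≤ N) {f : ℝ → ℝ} (hf : Measurable f) (r : ℝ) :
    ∫⁻ y : EuclideanSpace ℝ (Fin N), ENNReal.ofReal ((Iio r).indicator f ‖y‖) =
      (volume : Measure (EuclideanSpace ℝ (Fin N))).toSphere univ *
        ∫⁻ s in Ioo 0 r, ENNReal.ofReal (s ^ (N - 1) * f s) := by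
  have : Nonempty (Fin N) := ⟨⟨0, hN⟩⟩
  rw [lintegral_fun_norm volume
    (f := fun s => ENNReal.ofReal ((Iio r).indicator f s))
    ((hf.indicator measurableSet_Iio).ennreal_ofReal), finrank_euclideanSpace_fin,
    ← lintegral_indicator measurableSet_Ioi, ← lintegral_indicator measurableSet_Ioo]
  congr 2 with s
  by_cases h0 : 0 < s
  · rw [indicator_of_mem (mem_Ioi.2 h0)]
    by_cases h1 : s < r
    · rw [indicator_of_mem (mem_Iio.2 h1), indicator_of_mem (mem_Ioo.2 ⟨h0, h1⟩),
        ENNReal.ofReal_mul (by positivity)]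
    · rw [indicator_of_notMem (by simpa using h1), indicator_of_notMem (fun h => h1 h.2)]
      simp
  · rw [indicator_of_notMem (by simpa using h0), indicator_of_notMem (fun h => h0 h.1)]

lemma exists_lintegral_heatKernel_mul_norm_rpow_le {N : ℕ} (hN : 1 ≤ N) {g : ℝ} (hg0 : 0 < g)
    (hg : g < N) :
    ∃ C : ℝ, 0 < C ∧ ∀ (m : EuclideanSpace ℝ (Fin N)) (t : ℝ), 0 < t →
      ∫⁻ y, ENNReal.ofReal (heatKernel N (m - y) t) * ENNReal.ofReal (‖y‖ ^ (-g)) ≤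
        ENNReal.ofReal (C * t ^ (-g / 2)) := by
  set S := (volume : Measure (EuclideanSpace ℝ (Fin N))).toSphere univ with hS
  have hSt : S ≠ ⊤ := measure_ne_top _ _
  have hNg : 0 < N - g := sub_pos.2 hg
  refine ⟨(4 * Real.pi) ^ (-(N : ℝ) / 2) * (S.toReal / (N - g)) + 1, by positivity,
    fun m t ht => ?_⟩
  have hst : 0 < Real.sqrt t := Real.sqrt_pos.2 ht
  have hpt : ∀ y : EuclideanSpace ℝ (Fin N),
      ENNReal.ofReal (heatKernel N (m - y) t) * ENNReal.ofReal (‖y‖ ^ (-g)) ≤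
      ENNReal.ofReal ((4 * Real.pi * t) ^ (-(N : ℝ) / 2)) *
        ENNReal.ofReal ((Iio (Real.sqrt t)).indicator (fun s => s ^ (-g)) ‖y‖) +
      ENNReal.ofReal (heatKernel N (m - y) t) * ENNReal.ofReal (t ^ (-g / 2)) := fun y => by
    by_cases hy : ‖y‖ < Real.sqrt t
    · rw [indicator_of_mem (mem_Iio.2 hy)]
      refine le_trans ?_ le_self_add
      gcongr
      exact heatKernel_le N _ ht.le
    · refine le_trans ?_ le_add_self
      gcongr
      rw [not_lt] at hy
      calc ‖y‖ ^ (-g) ≤ Real.sqrt t ^ (-g) :=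
            Real.rpow_le_rpow_of_nonpos hst hy (by linarith)
        _ = t ^ (-g / 2) := by
            rw [Real.sqrt_eq_rpow, ← Real.rpow_mul ht.le]
            ring_nf
  have hint : ∫⁻ s in Ioo 0 (Real.sqrt t), ENNReal.ofReal (s ^ (N - 1) * s ^ (-g)) =
      ENNReal.ofReal (Real.sqrt t ^ (N - g) / (N - g)) := by
    have : ∀ s ∈ Ioo 0 (Real.sqrt t), ENNReal.ofReal (s ^ (N - 1) * s ^ (-g)) =
        ENNReal.ofReal (s ^ (N - g - 1)) := fun s hs => by
      rw [← Real.rpow_natCast, ← Real.rpow_add hs.1, Nat.cast_sub hN]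
      congr 2
      push_cast
      ring
    rw [setLIntegral_congr_fun measurableSet_Ioo this, lintegral_Ioo_rpow (by linarith) hst,
      sub_add_cancel]
  calc _ ≤ _ := lintegral_mono hpt
    _ = ENNReal.ofReal ((4 * Real.pi * t) ^ (-(N : ℝ) / 2)) *
          (S * ENNReal.ofReal (Real.sqrt t ^ (N - g) / (N - g))) +
        ENNReal.ofReal (t ^ (-g / 2)) := by
      rw [lintegral_add_right, lintegral_const_mul' _ _ ENNReal.ofReal_ne_top,
        lintegral_ball_fun_norm hN (by fun_prop), hint, lintegral_mul_const' _ _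
        ENNReal.ofReal_ne_top, lintegral_heatKernel N m ht, one_mul]
      exact (measurable_heatKernel_comp (by fun_prop) (by fun_prop)).ennreal_ofReal.mul_const _
    _ = _ := by
      rw [← ENNReal.ofReal_toReal hSt, ← ENNReal.ofReal_mul ENNReal.toReal_nonneg,
        ← ENNReal.ofReal_mul (by positivity), ← ENNReal.ofReal_add (by positivity) (by positivity),
        ENNReal.toReal_ofReal ENNReal.toReal_nonneg]
      congr 1
      rw [Real.mul_rpow (by positivity) ht.le, add_mul, one_mul, Real.sqrt_eq_rpow,
        ← Real.rpow_mul ht.le, show -g / 2 = -(N : ℝ) / 2 + 1 / 2 * (N - g) by ring,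
        Real.rpow_add ht]
      ring

/-- The integral operator of the Hardy parabolic equation on `[0, ∞]`-valued functions. -/
noncomputable def mildOp (N : ℕ) (γ p : ℝ) (u₀ : EuclideanSpace ℝ (Fin N) → ℝ)
    (U : EuclideanSpace ℝ (Fin N) → ℝ → ENNReal) (x : EuclideanSpace ℝ (Fin N)) (t : ℝ) :
    ENNReal :=
  (∫⁻ y, ENNReal.ofReal (heatKernel N (x - y) t) * ENNReal.ofReal (u₀ y)) +
    ∫⁻ s in Ioo 0 t, ∫⁻ y,
      ENNReal.ofReal (heatKernel N (x - y) (t - s)) * ENNReal.ofReal (‖y‖ ^ (-γ)) * U y s ^ p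

/-- The monotone iterates of `mildOp` starting from zero. -/
noncomputable def mildIter (N : ℕ) (γ p : ℝ) (u₀ : EuclideanSpace ℝ (Fin N) → ℝ) :
    ℕ → EuclideanSpace ℝ (Fin N) → ℝ → ENNReal
  | 0 => fun _ _ => 0
  | n + 1 => mildOp N γ p u₀ (mildIter N γ p u₀ n)

section Iteration

variable {N : ℕ} {γ p : ℝ} {u₀ : EuclideanSpace ℝ (Fin N) → ℝ}

lemma mildOp_mono (hp : 0 ≤ p) {U V : EuclideanSpace ℝ (Fin N) → ℝ → ENNReal} {t : ℝ}
    (h : ∀ y, ∀ s ∈ Ioo 0 t, U y s ≤ V y s) (x : EuclideanSpace ℝ (Fin N)) :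
    mildOp N γ p u₀ U x t ≤ mildOp N γ p u₀ V x t := by
  unfold mildOp
  refine add_le_add le_rfl ?_
  refine setLIntegral_mono' measurableSet_Ioo fun s hs => lintegral_mono fun y => ?_
  gcongr
  exact h y s hs

lemma measurable_mildOp_integrand {Y : Type*} [MeasurableSpace Y]
    {f g : Y → EuclideanSpace ℝ (Fin N)} {τ : Y → ℝ} {U : Y → ENNReal} (hf : Measurable f)
    (hg : Measurable g) (hτ : Measurable τ) (hU : Measurable U) :
    Measurable fun y => ENNReal.ofReal (heatKernel N (f y) (τ y)) *
      ENNReal.ofReal (‖g y‖ ^ (-γ)) * U y ^ p :=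
  ((measurable_heatKernel_comp hf hτ).ennreal_ofReal.mul
    (hg.norm.pow_const _).ennreal_ofReal).mul (hU.pow_const _)

lemma measurable_mildOp_inner {U : EuclideanSpace ℝ (Fin N) → ℝ → ENNReal}
    (hU : Measurable (Function.uncurry U)) :
    Measurable fun q : (EuclideanSpace ℝ (Fin N) × ℝ) × ℝ => ∫⁻ y,
      ENNReal.ofReal (heatKernel N (q.1.1 - y) (q.1.2 - q.2)) * ENNReal.ofReal (‖y‖ ^ (-γ)) *
        U y q.2 ^ p := by
  refine Measurable.lintegral_prod_right'
    (f := fun r : ((EuclideanSpace ℝ (Fin N) × ℝ) × ℝ) × EuclideanSpace ℝ (Fin N) =>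
      ENNReal.ofReal (heatKernel N (r.1.1.1 - r.2) (r.1.1.2 - r.1.2)) *
        ENNReal.ofReal (‖r.2‖ ^ (-γ)) * U r.2 r.1.2 ^ p) ?_
  exact measurable_mildOp_integrand (by fun_prop) (by fun_prop) (by fun_prop)
    (hU.comp (measurable_snd.prodMk (measurable_snd.comp measurable_fst)))

lemma measurable_mildOp {U : EuclideanSpace ℝ (Fin N) → ℝ → ENNReal} (hu₀ : Measurable u₀)
    (hU : Measurable (Function.uncurry U)) :
    Measurable (Function.uncurry (mildOp N γ p u₀ U)) := by
  refine Measurable.add ?_ ?_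
  · refine Measurable.lintegral_prod_right'
      (f := fun r : (EuclideanSpace ℝ (Fin N) × ℝ) × EuclideanSpace ℝ (Fin N) =>
        ENNReal.ofReal (heatKernel N (r.1.1 - r.2) r.1.2) * ENNReal.ofReal (u₀ r.2)) ?_
    exact (measurable_heatKernel_comp (by fun_prop) (by fun_prop)).ennreal_ofReal.mul
      (hu₀.comp measurable_snd).ennreal_ofReal
  · have h : (fun q : EuclideanSpace ℝ (Fin N) × ℝ => ∫⁻ s in Ioo 0 q.2, ∫⁻ y,
        ENNReal.ofReal (heatKernel N (q.1 - y) (q.2 - s)) * ENNReal.ofReal (‖y‖ ^ (-γ)) *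
          U y s ^ p) = fun q => ∫⁻ s, {r : (EuclideanSpace ℝ (Fin N) × ℝ) × ℝ |
            0 < r.2 ∧ r.2 < r.1.2}.indicator (fun r => ∫⁻ y,
              ENNReal.ofReal (heatKernel N (r.1.1 - y) (r.1.2 - r.2)) *
                ENNReal.ofReal (‖y‖ ^ (-γ)) * U y r.2 ^ p) (q, s) := by
      ext q
      rw [← lintegral_indicator measurableSet_Ioo]
      rfl
    rw [h]
    refine Measurable.lintegral_prod_right' ((measurable_mildOp_inner hU).indicator ?_)
    exact (measurableSet_lt measurable_const measurable_snd).inter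
      (measurableSet_lt measurable_snd (measurable_snd.comp measurable_fst))

lemma measurable_mildIter (hu₀ : Measurable u₀) (n : ℕ) :
    Measurable (Function.uncurry (mildIter N γ p u₀ n)) := by
  induction n with
  | zero => exact measurable_const
  | succ n ih => exact measurable_mildOp hu₀ ih

lemma monotone_mildIter (hp : 0 ≤ p) : Monotone (mildIter N γ p u₀) := by
  refine monotone_nat_of_le_succ fun n => ?_
  induction n with
  | zero => exact fun _ _ => zero_le
  | succ n ih => exact fun x t => mildOp_mono hp (fun y s _ => ih y s) x

lemma mildIter_le (hp : 0 ≤ p) {T : ℝ} {V : EuclideanSpace ℝ (Fin N) → ℝ → ENNReal}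
    (hV : ∀ x, ∀ t ∈ Ioo 0 T, mildOp N γ p u₀ V x t ≤ V x t) (n : ℕ) :
    ∀ x, ∀ t ∈ Ioo 0 T, mildIter N γ p u₀ n x t ≤ V x t := by
  induction n with
  | zero => exact fun _ _ _ => zero_le
  | succ n ih =>
    exact fun x t ht => (mildOp_mono hp (fun y s hs => ih y s ⟨hs.1, hs.2.trans ht.2⟩) x).trans
      (hV x t ht)

lemma mildOp_iSup_mildIter (hp : 0 < p) (hu₀ : Measurable u₀) (x : EuclideanSpace ℝ (Fin N))
    (t : ℝ) :
    mildOp N γ p u₀ (fun y s => ⨆ n, mildIter N γ p u₀ n y s) x t =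
      ⨆ n, mildIter N γ p u₀ n x t := by
  have hmono := monotone_mildIter (N := N) (γ := γ) (u₀ := u₀) hp.le
  have h1 : mildOp N γ p u₀ (fun y s => ⨆ n, mildIter N γ p u₀ n y s) x t =
      ⨆ n, mildOp N γ p u₀ (mildIter N γ p u₀ n) x t := by
    unfold mildOp
    rw [← ENNReal.add_iSup]
    congr 1
    have hpow : ∀ y s, (⨆ n, mildIter N γ p u₀ n y s) ^ p = ⨆ n, mildIter N γ p u₀ n y s ^ p :=
      fun y s => (ENNReal.orderIsoRpow p hp).map_iSup _
    simp only [hpow, ENNReal.mul_iSup]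
    have hmeas : ∀ n, Measurable fun s : ℝ => ∫⁻ y, ENNReal.ofReal (heatKernel N (x - y) (t - s)) *
        ENNReal.ofReal (‖y‖ ^ (-γ)) * mildIter N γ p u₀ n y s ^ p := fun n =>
      (measurable_mildOp_inner (measurable_mildIter hu₀ n)).comp (f := fun s : ℝ => ((x, t), s))
        (measurable_const.prodMk measurable_id)
    rw [← lintegral_iSup]
    · congr with s
      rw [lintegral_iSup]
      · exact fun n => measurable_mildOp_integrand (by fun_prop) (by fun_prop) (by fun_prop)
          ((measurable_mildIter hu₀ n).comp (measurable_id.prodMk measurable_const))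
      · intro n m hnm y
        dsimp only
        gcongr
        exact hmono hnm y s
    · exact hmeas
    · intro n m hnm s
      refine lintegral_mono fun y => ?_
      gcongr
      exact hmono hnm y s
  rw [h1]
  exact ((monotone_nat_of_le_succ fun n => hmono n.le_succ x t).iSup_nat_add 1)

/-- A finite supersolution produces a solution. -/
lemma exists_isSol_of_mildOp_le (hp : 0 < p) {T : ℝ} (hu₀ : Measurable u₀) (hu₀' : ∀ x, 0 ≤ u₀ x)
    {V : EuclideanSpace ℝ (Fin N) → ℝ → ENNReal} (hVtop : ∀ x, ∀ t ∈ Ioo 0 T, V x t ≠ ⊤)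
    (hV : ∀ x, ∀ t ∈ Ioo 0 T, mildOp N γ p u₀ V x t ≤ V x t) :
    ∃ u, IsSol N γ p T u₀ u := by
  set U : EuclideanSpace ℝ (Fin N) → ℝ → ENNReal := fun x t => ⨆ n, mildIter N γ p u₀ n x t
    with hU
  have hUm : Measurable (Function.uncurry U) := Measurable.iSup fun n => measurable_mildIter hu₀ n
  have hUV : ∀ x, ∀ t ∈ Ioo 0 T, U x t ≤ V x t := fun x t ht =>
    iSup_le fun n => mildIter_le hp.le hV n x t ht
  have hUtop : ∀ x, ∀ t ∈ Ioo 0 T, U x t ≠ ⊤ := fun x t ht =>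
    ne_top_of_le_ne_top (hVtop x t ht) (hUV x t ht)
  refine ⟨fun x t => (U x t).toReal, hUm.ennreal_toReal, fun x t => ENNReal.toReal_nonneg,
    Filter.Eventually.of_forall fun ⟨x, t⟩ ht => ?_⟩
  dsimp only at ht ⊢
  have hfix : U x t = mildOp N γ p u₀ U x t := (mildOp_iSup_mildIter hp hu₀ x t).symm
  have htop := hUtop x t ht
  rw [hfix, mildOp, ENNReal.add_ne_top] at htop
  rw [hfix, mildOp, ENNReal.toReal_add htop.1 htop.2]
  congr 1
  · rw [integral_eq_lintegral_of_nonneg_ae]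
    · simp only [ENNReal.ofReal_mul (heatKernel_nonneg N _ ht.1.le)]
    · exact Filter.Eventually.of_forall fun y => mul_nonneg (heatKernel_nonneg N _ ht.1.le) (hu₀' y)
    · exact ((measurable_heatKernel_comp (by fun_prop) (by fun_prop)).mul hu₀).aestronglyMeasurable
  · have hinner : Measurable fun s : ℝ => ∫⁻ y,
        ENNReal.ofReal (heatKernel N (x - y) (t - s)) * ENNReal.ofReal (‖y‖ ^ (-γ)) * U y s ^ p :=
      (measurable_mildOp_inner hUm).comp (f := fun s : ℝ => ((x, t), s))
        (measurable_const.prodMk measurable_id)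
    rw [← integral_toReal hinner.aemeasurable (ae_lt_top hinner htop.2)]
    refine setIntegral_congr_fun measurableSet_Ioo fun s hs => ?_
    have hts : 0 ≤ t - s := sub_nonneg.2 hs.2.le
    rw [integral_eq_lintegral_of_nonneg_ae]
    · congr 1
      refine lintegral_congr fun y => ?_
      have hnn := heatKernel_nonneg N (x - y) hts
      rw [ENNReal.ofReal_mul (by positivity), ENNReal.ofReal_mul hnn,
        ← ENNReal.ofReal_rpow_of_nonneg ENNReal.toReal_nonneg hp.le,
        ENNReal.ofReal_toReal (hUtop y s ⟨hs.1, hs.2.trans ht.2⟩)]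
    · refine Filter.Eventually.of_forall fun y => ?_
      have hnn := heatKernel_nonneg N (x - y) hts
      dsimp only [Pi.zero_apply]
      positivity
    · have hk : Measurable fun y => heatKernel N (x - y) (t - s) :=
        measurable_heatKernel_comp (by fun_prop) (by fun_prop)
      have hUs : Measurable fun y => U y s := hUm.comp (measurable_id.prodMk measurable_const)
      exact ((hk.mul (measurable_norm.pow_const _)).mul
        (hUs.ennreal_toReal.pow_const _)).aestronglyMeasurable

end Iteration

/-- The function `w * log (e + w) ^ (-1/2)`. -/
noncomputable def logDamp (w : ℝ) : ℝ := w * expLog w ^ (-(1 / 2) : ℝ)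

lemma logDamp_nonneg {w : ℝ} (hw : 0 ≤ w) : 0 ≤ logDamp w :=
  mul_nonneg hw (Real.rpow_nonneg (expLog_pos hw).le _)

lemma expLog_rpow_neg_le {x y A m : ℝ} (hx : 0 ≤ x) (hy : 0 ≤ y) (hA : 0 < A) (hm : 0 ≤ m)
    (h : expLog x ≤ A * expLog y) : expLog y ^ (-m) ≤ A ^ m * expLog x ^ (-m) := by
  have hEx := expLog_pos hx
  have hEy := expLog_pos hy
  calc expLog y ^ (-m) = A ^ m * (A * expLog y) ^ (-m) := by
        rw [Real.mul_rpow hA.le hEy.le, ← mul_assoc, ← Real.rpow_add hA, add_neg_cancel,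
          Real.rpow_zero, one_mul]
    _ ≤ A ^ m * expLog x ^ (-m) := by
        gcongr ?_ * ?_
        exact Real.rpow_le_rpow_of_nonpos hEx h (by linarith)

lemma exists_logDamp_le_mul_add :
    ∃ A : ℝ, 0 < A ∧ ∀ h w : ℝ, 0 ≤ h → 0 ≤ w →
      logDamp h ≤ expLog w ^ (-(1 / 2) : ℝ) * (h + A * w) := by
  obtain ⟨A, hA, H⟩ := exists_rpow_mul_expLog_le (a := 1) (m := 1 / 2) one_pos (by norm_num)
  refine ⟨A, hA, fun h w hh hw => ?_⟩
  have hEw := expLog_pos hw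
  have hp : 0 < expLog w ^ (-(1 / 2) : ℝ) := Real.rpow_pos_of_pos hEw _
  rcases le_total w h with hwh | hwh
  · have h1 : expLog h ^ (-(1 / 2) : ℝ) ≤ expLog w ^ (-(1 / 2) : ℝ) :=
      Real.rpow_le_rpow_of_nonpos hEw (expLog_le_expLog hw hwh) (by norm_num)
    calc logDamp h ≤ h * expLog w ^ (-(1 / 2) : ℝ) := mul_le_mul_of_nonneg_left h1 hh
      _ ≤ _ := by nlinarith [mul_nonneg hp.le (mul_nonneg hA.le hw)]
  · have h1 := H h w hh hwh
    rw [Real.rpow_one, Real.rpow_one] at h1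
    calc logDamp h ≤ A * (w * expLog w ^ (-(1 / 2) : ℝ)) := h1
      _ ≤ _ := by nlinarith [mul_nonneg hp.le hh]

lemma exists_le_logDamp (n : ℝ) (hn : 0 < n) (m : ℝ) (hm : 0 < m) :
    ∃ A : ℝ, 0 < A ∧ ∀ Y : ℝ, 0 ≤ Y →
      Y ^ n * expLog Y ^ (-(m + 1 / 2)) ≤ A * logDamp (Y ^ n * expLog Y ^ (-m) + 1) ∧
        1 ≤ A * logDamp (Y ^ n * expLog Y ^ (-m) + 1) := by
  obtain ⟨A, hA, H⟩ := exists_rpow_mul_expLog_le (a := 1) (m := 1 / 2) one_pos (by norm_num)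
  have hE1 := expLog_pos zero_le_one
  refine ⟨max ((2 * (n + 2)) ^ (1 / 2 : ℝ)) (expLog 1 ^ (1 / 2 : ℝ) * A), by positivity,
    fun Y hY => ?_⟩
  have hEY := expLog_pos hY
  have hEY1 := one_le_expLog hY
  have hYn : 0 ≤ Y ^ n := Real.rpow_nonneg hY n
  set h := Y ^ n * expLog Y ^ (-m) + 1 with hh
  have hP : 0 ≤ Y ^ n * expLog Y ^ (-m) := mul_nonneg hYn (Real.rpow_nonneg hEY.le _)
  have hP1 : Y ^ n * expLog Y ^ (-m) ≤ Y ^ n :=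
    mul_le_of_le_one_right hYn (Real.rpow_le_one_of_one_le_of_nonpos hEY1 (by linarith))
  have hh1 : 1 ≤ h := by linarith
  have hh0 : 0 ≤ h := by linarith
  have hL := logDamp_nonneg hh0
  have hEh := expLog_pos hh0
  constructor
  · refine le_trans ?_ (mul_le_mul_of_nonneg_right (le_max_left _ _) hL)
    have h1 : expLog h ≤ (2 * (n + 2)) * expLog Y := by
      have he : 1 ≤ Real.exp 1 := by linarith [Real.add_one_le_exp (1 : ℝ)]
      have h2 : expLog h ≤ Real.log 2 + expLog (Y ^ n) := by
        rw [expLog, expLog, ← Real.log_mul (by norm_num) (by positivity)]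
        exact Real.log_le_log (by positivity) (by linarith)
      have h3 := expLog_rpow_le hn hY
      have h4 : Real.log 2 ≤ 1 := by linarith [Real.log_two_lt_d9]
      nlinarith
    have h2 := expLog_rpow_neg_le hh0 hY (by positivity) (m := 1 / 2) (by norm_num) h1
    calc Y ^ n * expLog Y ^ (-(m + 1 / 2))
        = Y ^ n * expLog Y ^ (-m) * expLog Y ^ (-(1 / 2) : ℝ) := by
          rw [neg_add, Real.rpow_add hEY, mul_assoc]
      _ ≤ h * ((2 * (n + 2)) ^ (1 / 2 : ℝ) * expLog h ^ (-(1 / 2) : ℝ)) := by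
          gcongr
          linarith
      _ = _ := by rw [logDamp]; ring
  · refine le_trans ?_ (mul_le_mul_of_nonneg_right (le_max_right _ _) hL)
    have h1 := H 1 h zero_le_one hh1
    rw [Real.rpow_one, Real.rpow_one, one_mul] at h1
    calc (1 : ℝ) = expLog 1 ^ (1 / 2 : ℝ) * expLog 1 ^ (-(1 / 2) : ℝ) := by
          rw [← Real.rpow_add hE1, add_neg_cancel, Real.rpow_zero]
      _ ≤ expLog 1 ^ (1 / 2 : ℝ) * (A * (h * expLog h ^ (-(1 / 2) : ℝ))) := by gcongr
      _ = _ := by rw [logDamp]; ring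

lemma expLog_le_of_le_mul_rpow {C n X w : ℝ} (hC : 0 ≤ C) (hn : 0 < n) (hX : 0 ≤ X) (hw : 0 ≤ w)
    (h : w ≤ C * X ^ n) : expLog w ≤ ((1 + Real.log (1 + C)) * (n + 2)) * expLog X := by
  have hlog : 0 ≤ Real.log (1 + C) := Real.log_nonneg (by linarith)
  calc expLog w ≤ expLog (C * X ^ n) := expLog_le_expLog hw h
    _ ≤ (1 + Real.log (1 + C)) * expLog (X ^ n) := expLog_mul_le hC (Real.rpow_nonneg hX _)
    _ ≤ (1 + Real.log (1 + C)) * ((n + 2) * expLog X) := by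
        gcongr
        exact expLog_rpow_le hn hX
    _ = _ := by ring

/-- `log (e + X)` is controlled by the logarithm of `C * X ^ n * log (e + X) ^ (-m)`. -/
lemma exists_expLog_le_of_rpow_mul {C n m : ℝ} (hC : 0 < C) (hn : 0 < n) (hm : 0 < m) :
    ∃ A : ℝ, 0 < A ∧ ∀ X : ℝ, 1 ≤ X →
      expLog X ≤ A * expLog (C * (X ^ n * expLog X ^ (-m))) := by
  obtain ⟨A, hA, H⟩ := exists_rpow_mul_expLog_le (a := n / 2) (m := m) (by positivity) hm
  have hE1 := expLog_pos zero_le_one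
  set D := expLog 1 ^ m * A / C with hD
  have hD0 : 0 < D := by positivity
  have hlog : 0 ≤ Real.log (1 + D) := Real.log_nonneg (by linarith)
  refine ⟨((n / 2)⁻¹ + 2) * (1 + Real.log (1 + D)), by positivity, fun X hX => ?_⟩
  have hX0 : 0 ≤ X := by linarith
  have hEX := expLog_pos hX0
  have hXn : 0 ≤ X ^ (n / 2) := Real.rpow_nonneg hX0 _
  have h1 : X ^ (n / 2) ≤ D * (C * (X ^ n * expLog X ^ (-m))) := by
    have h2 := H 1 X zero_le_one hX
    rw [Real.one_rpow, one_mul] at h2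
    calc X ^ (n / 2) = X ^ (n / 2) * (expLog 1 ^ m * expLog 1 ^ (-m)) := by
          rw [← Real.rpow_add hE1, add_neg_cancel, Real.rpow_zero, mul_one]
      _ ≤ X ^ (n / 2) * (expLog 1 ^ m * (A * (X ^ (n / 2) * expLog X ^ (-m)))) := by gcongr
      _ = expLog 1 ^ m * A * (X ^ (n / 2) * X ^ (n / 2) * expLog X ^ (-m)) := by ring
      _ = _ := by
          rw [← Real.rpow_add (by linarith), add_halves, hD]
          field_simp
  calc expLog X = expLog ((X ^ (n / 2)) ^ (n / 2)⁻¹) := by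
        rw [← Real.rpow_mul hX0, mul_inv_cancel₀ (by positivity), Real.rpow_one]
    _ ≤ ((n / 2)⁻¹ + 2) * expLog (X ^ (n / 2)) := expLog_rpow_le (by positivity) hXn
    _ ≤ ((n / 2)⁻¹ + 2) * expLog (D * (C * (X ^ n * expLog X ^ (-m)))) := by
        gcongr
        exact expLog_le_expLog hXn h1
    _ ≤ ((n / 2)⁻¹ + 2) * ((1 + Real.log (1 + D)) * expLog (C * (X ^ n * expLog X ^ (-m)))) := by
        gcongr
        exact expLog_mul_le hD0.le (by positivity)
    _ = _ := by ring

lemma exists_logDamp_rpow_le {C n q : ℝ} (hC : 0 < C) (hn : 0 < n) (hq : 0 < q) (hq2 : q < 2) :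
    ∃ A : ℝ, 0 < A ∧ ∀ X w : ℝ, 1 ≤ X → 0 ≤ w →
      w ≤ C * (X ^ n * expLog X ^ (-(1 / q - 1 / 2))) →
      logDamp w ^ (1 + q) ≤ A * (X ^ (n * q) * expLog X ^ (-(1 + 1 / 2) : ℝ)) * w := by
  have hm : 0 < 1 / q - 1 / 2 := by
    rw [sub_pos]
    exact one_div_lt_one_div_of_lt hq hq2
  obtain ⟨A, hA, H⟩ := exists_rpow_mul_expLog_le (a := q) (m := (1 + q) / 2) hq (by positivity)
  obtain ⟨D, hD, HD⟩ := exists_expLog_le_of_rpow_mul hC hn hm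
  refine ⟨A * (C ^ q * D ^ ((1 + q) / 2)), by positivity, fun X w hX hw hwK => ?_⟩
  have hX0 : 0 < X := by linarith
  have hEX := expLog_pos hX0.le
  set K := C * (X ^ n * expLog X ^ (-(1 / q - 1 / 2))) with hK
  have hK0 : 0 ≤ K := by positivity
  have hEw := expLog_pos hw
  have h1 : logDamp w ^ (1 + q) = w ^ q * expLog w ^ (-((1 + q) / 2)) * w := by
    rw [logDamp, Real.mul_rpow hw (by positivity), ← Real.rpow_mul hEw.le,
      Real.rpow_add_of_nonneg hw zero_le_one hq.le, Real.rpow_one]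
    ring_nf
  have h2 : K ^ q = C ^ q * (X ^ (n * q) * expLog X ^ (-(1 - q / 2))) := by
    rw [hK, Real.mul_rpow hC.le (by positivity), Real.mul_rpow (by positivity) (by positivity),
      ← Real.rpow_mul hX0.le, ← Real.rpow_mul hEX.le]
    congr 3
    field_simp
  have h3 := expLog_rpow_neg_le hX0.le hK0 hD (m := (1 + q) / 2) (by positivity) (HD X hX)
  rw [h1]
  refine mul_le_mul_of_nonneg_right ?_ hw
  calc w ^ q * expLog w ^ (-((1 + q) / 2)) ≤ A * (K ^ q * expLog K ^ (-((1 + q) / 2))) :=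
        H w K hw hwK
    _ ≤ A * (C ^ q * (X ^ (n * q) * expLog X ^ (-(1 - q / 2))) *
          (D ^ ((1 + q) / 2) * expLog X ^ (-((1 + q) / 2)))) := by
        rw [h2]
        gcongr
    _ = A * (C ^ q * D ^ ((1 + q) / 2)) *
          (X ^ (n * q) * (expLog X ^ (-(1 - q / 2)) * expLog X ^ (-((1 + q) / 2)))) := by ring
    _ = _ := by
        rw [← Real.rpow_add hEX]
        congr 3
        ring

/-- The singular profile with logarithmic exponent `1 + m` at length scale `τ`, shifted by one. -/
noncomputable def logProfile (N : ℕ) (m τ : ℝ) (z y : EuclideanSpace ℝ (Fin N)) : ℝ :=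
  (τ / ‖y - z‖) ^ (N : ℝ) * expLog (τ / ‖y - z‖) ^ (-(1 + m)) + 1

lemma measurable_logProfile (N : ℕ) (m τ : ℝ) (z : EuclideanSpace ℝ (Fin N)) :
    Measurable (logProfile N m τ z) := by
  have h : Measurable fun y : EuclideanSpace ℝ (Fin N) => τ / ‖y - z‖ := by fun_prop
  exact ((h.pow_const _).mul ((measurable_expLog.comp h).pow_const _)).add_const 1

lemma one_le_logProfile {N : ℕ} {m τ : ℝ} (hτ : 0 ≤ τ) (z y : EuclideanSpace ℝ (Fin N)) :
    1 ≤ logProfile N m τ z y := by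
  have h : 0 ≤ τ / ‖y - z‖ := by positivity
  have := expLog_pos h
  unfold logProfile
  have : 0 ≤ (τ / ‖y - z‖) ^ (N : ℝ) * expLog (τ / ‖y - z‖) ^ (-(1 + m)) := by positivity
  linarith

lemma lintegral_ball_logProfile_le {N : ℕ} (hN : 1 ≤ N) {m τ r : ℝ} (hm : 0 < m) (hr : 0 < r)
    (hrτ : r ≤ τ) (z : EuclideanSpace ℝ (Fin N)) :
    ∫⁻ y, ENNReal.ofReal ((Iio r).indicator
        (fun s => (τ / s) ^ (N : ℝ) * expLog (τ / s) ^ (-(1 + m))) ‖y - z‖) ≤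
      (volume : Measure (EuclideanSpace ℝ (Fin N))).toSphere univ *
        ENNReal.ofReal (τ ^ (N : ℝ) * ((1 + Real.exp 1) / m * expLog (τ / r) ^ (-m))) := by
  have hτ : 0 < τ := hr.trans_le hrτ
  have hmeas : Measurable fun s : ℝ => (τ / s) ^ (N : ℝ) * expLog (τ / s) ^ (-(1 + m)) := by
    have h : Measurable fun s : ℝ => τ / s := by fun_prop
    exact (h.pow_const _).mul ((measurable_expLog.comp h).pow_const _)
  rw [lintegral_sub_right_eq_self (fun y : EuclideanSpace ℝ (Fin N) => ENNReal.ofReal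
    ((Iio r).indicator (fun s => (τ / s) ^ (N : ℝ) * expLog (τ / s) ^ (-(1 + m))) ‖y‖)) z,
    lintegral_ball_fun_norm hN hmeas]
  gcongr
  have h1 : ∀ s ∈ Ioo 0 r, ENNReal.ofReal (s ^ (N - 1) *
      ((τ / s) ^ (N : ℝ) * expLog (τ / s) ^ (-(1 + m)))) =
      ENNReal.ofReal (τ ^ (N : ℝ)) * ENNReal.ofReal (s⁻¹ * expLog (τ / s) ^ (-(1 + m))) :=
    fun s hs => by
      have hs0 : s ≠ 0 := hs.1.ne'
      rw [← ENNReal.ofReal_mul (by positivity), Real.rpow_natCast, Real.rpow_natCast, div_pow]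
      congr 1
      have h2 : s ^ N = s ^ (N - 1) * s := by rw [← pow_succ, Nat.sub_add_cancel hN]
      rw [h2]
      field_simp
  rw [setLIntegral_congr_fun measurableSet_Ioo h1, lintegral_const_mul' _ _ ENNReal.ofReal_ne_top,
    ENNReal.ofReal_mul (by positivity)]
  gcongr
  exact lintegral_inv_mul_expLog_le hm hr hrτ

/-- Smoothing estimate for the heat flow of the singular profile. -/
lemma exists_lintegral_heatKernel_logProfile_le {N : ℕ} (hN : 1 ≤ N) {m : ℝ} (hm : 0 < m) :
    ∃ C : ℝ, 0 < C ∧ ∀ T t : ℝ, 0 < t → t < T → ∀ x z : EuclideanSpace ℝ (Fin N),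
      ∫⁻ y, ENNReal.ofReal (heatKernel N (x - y) t) *
          ENNReal.ofReal (logProfile N m (Real.sqrt T) z y) ≤
        ENNReal.ofReal (C * ((T / t) ^ ((N : ℝ) / 2) * expLog (T / t) ^ (-m))) := by
  have hN0 : (0 : ℝ) < N := by exact_mod_cast hN
  obtain ⟨A, hA, HA⟩ := exists_rpow_mul_expLog_le (a := N) (m := 1 + m) hN0 (by positivity)
  obtain ⟨B, hB, HB⟩ := exists_rpow_mul_expLog_le (a := (N : ℝ) / 2) (m := m) (by positivity) hm
  have hE1 := expLog_pos zero_le_one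
  set S := (volume : Measure (EuclideanSpace ℝ (Fin N))).toSphere univ with hS
  have hSt : S ≠ ⊤ := measure_ne_top _ _
  set D := A * 4 ^ (1 + m) + expLog 1 ^ m * B with hD
  set M := (4 * Real.pi) ^ (-(N : ℝ) / 2) * (S.toReal * ((1 + Real.exp 1) / m * 4 ^ m)) with hM
  have hD0 : 0 < D := by positivity
  have hM0 : 0 ≤ M := by positivity
  refine ⟨M + D, by positivity, fun T t ht htT x z => ?_⟩
  have hT : 0 < T := ht.trans htT
  set X := T / t with hX
  have hX1 : 1 ≤ X := (one_le_div ht).2 htT.le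
  have hX0 : 0 < X := by linarith
  have hEX := expLog_pos hX0.le
  have hst : 0 < Real.sqrt t := Real.sqrt_pos.2 ht
  have hsq : Real.sqrt T / Real.sqrt t = Real.sqrt X := (Real.sqrt_div' _ ht.le).symm
  have hEs : expLog X ≤ 4 * expLog (Real.sqrt X) := by
    have := expLog_rpow_le (d := 2) two_pos (Real.sqrt_nonneg X)
    rw [Real.rpow_two, Real.sq_sqrt hX0.le] at this
    linarith
  have hEs' : ∀ k : ℝ, 0 ≤ k → expLog (Real.sqrt X) ^ (-k) ≤ 4 ^ k * expLog X ^ (-k) :=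
    fun k hk => expLog_rpow_neg_le hX0.le (Real.sqrt_nonneg X) four_pos hk hEs
  set Y := X ^ ((N : ℝ) / 2) * expLog X ^ (-m) with hY
  have hY0 : 0 ≤ Y := by positivity
  set F : ℝ → ℝ := fun s => (Real.sqrt T / s) ^ (N : ℝ) * expLog (Real.sqrt T / s) ^ (-(1 + m))
    with hF
  have hF_far : ∀ s, Real.sqrt t ≤ s → F s ≤ A * 4 ^ (1 + m) * Y := fun s hs => by
    have hs0 : 0 < s := hst.trans_le hs
    calc F s ≤ A * (Real.sqrt X ^ (N : ℝ) * expLog (Real.sqrt X) ^ (-(1 + m))) := by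
          refine HA _ _ (by positivity) ?_
          rw [← hsq]
          gcongr
      _ ≤ A * (X ^ ((N : ℝ) / 2) * (4 ^ (1 + m) * expLog X ^ (-m))) := by
          have h1 : expLog X ^ (-(1 + m)) ≤ expLog X ^ (-m) :=
            Real.rpow_le_rpow_of_exponent_le (one_le_expLog hX0.le) (by linarith)
          have h2 : Real.sqrt X ^ (N : ℝ) = X ^ ((N : ℝ) / 2) := by
            rw [Real.sqrt_eq_rpow, ← Real.rpow_mul hX0.le]
            ring_nf
          have h3 := hEs' (1 + m) (by positivity)
          rw [h2]
          gcongr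
          exact h3.trans (by gcongr)
      _ = _ := by rw [hY]; ring
  have hone : 1 ≤ expLog 1 ^ m * B * Y := by
    have h1 := HB 1 X zero_le_one hX1
    rw [Real.one_rpow, one_mul] at h1
    calc (1 : ℝ) = expLog 1 ^ m * expLog 1 ^ (-m) := by
          rw [← Real.rpow_add hE1, add_neg_cancel, Real.rpow_zero]
      _ ≤ expLog 1 ^ m * (B * Y) := by gcongr
      _ = _ := by ring
  have hpt : ∀ y, ENNReal.ofReal (heatKernel N (x - y) t) *
        ENNReal.ofReal (logProfile N m (Real.sqrt T) z y) ≤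
      ENNReal.ofReal ((4 * Real.pi * t) ^ (-(N : ℝ) / 2)) *
        ENNReal.ofReal ((Iio (Real.sqrt t)).indicator F ‖y - z‖) +
      ENNReal.ofReal (heatKernel N (x - y) t) * ENNReal.ofReal (D * Y) := fun y => by
    have hFy : 0 ≤ F ‖y - z‖ := by
      have h : 0 ≤ Real.sqrt T / ‖y - z‖ := by positivity
      have := expLog_pos h
      simp only [hF]
      positivity
    have hAY : 0 ≤ A * 4 ^ (1 + m) * Y := by positivity
    have hle : logProfile N m (Real.sqrt T) z y ≤
        (Iio (Real.sqrt t)).indicator F ‖y - z‖ + D * Y := by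
      have h0 : logProfile N m (Real.sqrt T) z y = F ‖y - z‖ + 1 := rfl
      have h1 : D * Y = A * 4 ^ (1 + m) * Y + expLog 1 ^ m * B * Y := by rw [hD]; ring
      rw [h0, h1]
      by_cases hy : ‖y - z‖ < Real.sqrt t
      · rw [indicator_of_mem (mem_Iio.2 hy)]
        linarith
      · rw [indicator_of_notMem (by simpa using hy)]
        linarith [hF_far _ (not_lt.1 hy)]
    calc _ ≤ ENNReal.ofReal (heatKernel N (x - y) t) *
          (ENNReal.ofReal ((Iio (Real.sqrt t)).indicator F ‖y - z‖) + ENNReal.ofReal (D * Y)) := by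
          gcongr
          exact (ENNReal.ofReal_le_ofReal hle).trans ENNReal.ofReal_add_le
      _ ≤ _ := by
          rw [mul_add]
          gcongr
          exact heatKernel_le N _ ht.le
  calc _ ≤ _ := lintegral_mono hpt
    _ = ENNReal.ofReal ((4 * Real.pi * t) ^ (-(N : ℝ) / 2)) *
          (∫⁻ y, ENNReal.ofReal ((Iio (Real.sqrt t)).indicator F ‖y - z‖)) +
        ENNReal.ofReal (D * Y) := by
      rw [lintegral_add_right, lintegral_const_mul' _ _ ENNReal.ofReal_ne_top,
        lintegral_mul_const' _ _ ENNReal.ofReal_ne_top, lintegral_heatKernel N x ht, one_mul]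
      exact (measurable_heatKernel_comp (by fun_prop) (by fun_prop)).ennreal_ofReal.mul_const _
    _ ≤ ENNReal.ofReal ((4 * Real.pi * t) ^ (-(N : ℝ) / 2)) *
          (S * ENNReal.ofReal (Real.sqrt T ^ (N : ℝ) *
            ((1 + Real.exp 1) / m * (4 ^ m * expLog X ^ (-m))))) + ENNReal.ofReal (D * Y) := by
      gcongr
      refine (lintegral_ball_logProfile_le hN hm hst (Real.sqrt_le_sqrt htT.le) z).trans ?_
      rw [hsq]
      gcongr
      exact hEs' m hm.le
    _ = _ := by
      rw [← ENNReal.ofReal_toReal hSt, ← ENNReal.ofReal_mul ENNReal.toReal_nonneg,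
        ← ENNReal.ofReal_mul (by positivity), ← ENNReal.ofReal_add (by positivity) (by positivity)]
      congr 1
      have h1 : (4 * Real.pi * t) ^ (-(N : ℝ) / 2) * Real.sqrt T ^ (N : ℝ) =
          (4 * Real.pi) ^ (-(N : ℝ) / 2) * X ^ ((N : ℝ) / 2) := by
        rw [Real.mul_rpow (by positivity) ht.le, Real.sqrt_eq_rpow, ← Real.rpow_mul hT.le, hX,
          Real.div_rpow hT.le ht.le, neg_div, Real.rpow_neg ht.le]
        ring_nf
      rw [add_mul, hM, hY]
      linear_combination (S.toReal * ((1 + Real.exp 1) / m * (4 ^ m * expLog X ^ (-m)))) * h1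

/-- The heat semigroup acting on a nonnegative weighted caloric function. -/
lemma lintegral_heatKernel_mul_norm_rpow_mul_le {N : ℕ} {g C : ℝ}
    (hC : ∀ (m : EuclideanSpace ℝ (Fin N)) (t : ℝ), 0 < t →
      ∫⁻ y, ENNReal.ofReal (heatKernel N (m - y) t) * ENNReal.ofReal (‖y‖ ^ (-g)) ≤
        ENNReal.ofReal (C * t ^ (-g / 2)))
    {h : EuclideanSpace ℝ (Fin N) → ENNReal} (hh : Measurable h) {s t : ℝ} (hs : 0 < s)
    (hst : s < t) (x : EuclideanSpace ℝ (Fin N)) :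
    ∫⁻ y, ENNReal.ofReal (heatKernel N (x - y) (t - s)) * ENNReal.ofReal (‖y‖ ^ (-g)) *
        (∫⁻ w, ENNReal.ofReal (heatKernel N (y - w) s) * h w) ≤
      ENNReal.ofReal (C * (s * (t - s) / t) ^ (-g / 2)) *
        ∫⁻ w, ENNReal.ofReal (heatKernel N (x - w) t) * h w := by
  have ht : 0 < t := hs.trans hst
  have hts : 0 < t - s := sub_pos.2 hst
  have hσ : 0 < s * (t - s) / t := by positivity
  have hm1 : ∀ y r, Measurable fun w : EuclideanSpace ℝ (Fin N) =>
      ENNReal.ofReal (heatKernel N (y - w) r) * h w := fun y r =>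
    (measurable_heatKernel_comp (by fun_prop) (by fun_prop)).ennreal_ofReal.mul hh
  have hm2 : Measurable fun q : EuclideanSpace ℝ (Fin N) × EuclideanSpace ℝ (Fin N) =>
      ENNReal.ofReal (heatKernel N (x - q.1) (t - s)) * ENNReal.ofReal (‖q.1‖ ^ (-g)) *
        (ENNReal.ofReal (heatKernel N (q.1 - q.2) s) * h q.2) :=
    ((measurable_heatKernel_comp (by fun_prop) (by fun_prop)).ennreal_ofReal.mul
      (measurable_fst.norm.pow_const _).ennreal_ofReal).mul
      ((measurable_heatKernel_comp (by fun_prop) (by fun_prop)).ennreal_ofReal.mul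
        (hh.comp measurable_snd))
  calc _ = ∫⁻ y, ∫⁻ w, ENNReal.ofReal (heatKernel N (x - y) (t - s)) *
        ENNReal.ofReal (‖y‖ ^ (-g)) * (ENNReal.ofReal (heatKernel N (y - w) s) * h w) := by
        refine lintegral_congr fun y => ?_
        rw [lintegral_const_mul _ (hm1 y s)]
    _ = ∫⁻ w, ∫⁻ y, ENNReal.ofReal (heatKernel N (x - y) (t - s)) *
        ENNReal.ofReal (‖y‖ ^ (-g)) * (ENNReal.ofReal (heatKernel N (y - w) s) * h w) :=
        lintegral_lintegral_swap hm2.aemeasurable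
    _ ≤ ∫⁻ w, ENNReal.ofReal (C * (s * (t - s) / t) ^ (-g / 2)) *
          (ENNReal.ofReal (heatKernel N (x - w) t) * h w) := by
        refine lintegral_mono fun w => ?_
        have e : ∀ y, ENNReal.ofReal (heatKernel N (x - y) (t - s)) *
            ENNReal.ofReal (‖y‖ ^ (-g)) * (ENNReal.ofReal (heatKernel N (y - w) s) * h w) =
            (ENNReal.ofReal (heatKernel N (x - w) t) * h w) *
              (ENNReal.ofReal (heatKernel N (((s / t) • x + ((t - s) / t) • w) - y)
                (s * (t - s) / t)) * ENNReal.ofReal (‖y‖ ^ (-g))) := fun y => by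
          have := congrArg ENNReal.ofReal (heatKernel_mul_heatKernel N x y w hs hst)
          rw [ENNReal.ofReal_mul (heatKernel_nonneg N _ hts.le),
            ENNReal.ofReal_mul (heatKernel_nonneg N _ ht.le)] at this
          calc _ = ENNReal.ofReal (heatKernel N (x - y) (t - s)) *
                ENNReal.ofReal (heatKernel N (y - w) s) * (ENNReal.ofReal (‖y‖ ^ (-g)) * h w) := by
                ring
            _ = _ := by
                rw [this]
                ring
        simp only [e]
        rw [lintegral_const_mul, mul_comm]
        · gcongr
          exact hC _ _ hσ
        · exact (measurable_heatKernel_comp (by fun_prop) (by fun_prop)).ennreal_ofReal.mul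
            (measurable_norm.pow_const _).ennreal_ofReal
    _ = _ := lintegral_const_mul _ (hm1 x t)

lemma lintegral_time_le {T t a : ℝ} (ha0 : 0 < a) (ha : a < 1) (ht : 0 < t) (htT : t < T) :
    ∫⁻ s in Ioo 0 t, ENNReal.ofReal
        (s⁻¹ * expLog (T / s) ^ (-(1 + 1 / 2) : ℝ) * (1 - s / t) ^ (-a)) ≤
      ENNReal.ofReal ((2 * ((1 + Real.exp 1) / (1 / 2)) + 2 / (-a + 1)) *
        expLog (T / t) ^ (-(1 / 2) : ℝ)) := by
  have hT : 0 < T := ht.trans htT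
  have h1a : 0 < -a + 1 := by linarith
  have hEt := expLog_pos (x := T / t) (by positivity)
  have hpt : ∀ s ∈ Ioo 0 t, ENNReal.ofReal
        (s⁻¹ * expLog (T / s) ^ (-(1 + 1 / 2) : ℝ) * (1 - s / t) ^ (-a)) ≤
      ENNReal.ofReal 2 * ENNReal.ofReal (s⁻¹ * expLog (T / s) ^ (-(1 + 1 / 2) : ℝ)) +
      ENNReal.ofReal (2 / t * expLog (T / t) ^ (-(1 / 2) : ℝ)) *
        ENNReal.ofReal ((1 - s / t) ^ (-a)) := fun s hs => by
    have hs0 : 0 < s := hs.1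
    have hEs := expLog_pos (x := T / s) (by positivity)
    have hst : s / t < 1 := (div_lt_one ht).2 hs.2
    have h1s : 0 < 1 - s / t := by linarith
    rcases le_total (s / t) (1 / 2) with h | h
    · refine le_trans ?_ le_self_add
      rw [← ENNReal.ofReal_mul two_pos.le, mul_comm 2]
      gcongr
      calc (1 - s / t) ^ (-a) ≤ (1 / 2 : ℝ) ^ (-a) :=
            Real.rpow_le_rpow_of_nonpos (by norm_num) (by linarith) (by linarith)
        _ ≤ (1 / 2 : ℝ) ^ (-1 : ℝ) :=
            Real.rpow_le_rpow_of_exponent_ge (by norm_num) (by norm_num) (by linarith)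
        _ = 2 := by rw [Real.rpow_neg_one]; norm_num
    · refine le_trans ?_ le_add_self
      rw [← ENNReal.ofReal_mul (by positivity)]
      gcongr
      · rw [inv_eq_one_div, div_le_div_iff₀ hs0 ht]
        rw [div_le_div_iff₀ two_pos ht] at h
        linarith
      · calc expLog (T / s) ^ (-(1 + 1 / 2) : ℝ) ≤ expLog (T / t) ^ (-(1 + 1 / 2) : ℝ) := by
              refine Real.rpow_le_rpow_of_nonpos hEt (expLog_le_expLog (by positivity) ?_)
                (by norm_num)
              gcongr
              exact hs.2.le
          _ ≤ _ := Real.rpow_le_rpow_of_exponent_le (one_le_expLog (by positivity)) (by norm_num)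
  have hmeas : Measurable fun s : ℝ => ENNReal.ofReal (2 / t * expLog (T / t) ^ (-(1 / 2) : ℝ)) *
      ENNReal.ofReal ((1 - s / t) ^ (-a)) := by fun_prop
  calc _ ≤ _ := setLIntegral_mono' measurableSet_Ioo hpt
    _ = ENNReal.ofReal 2 *
          (∫⁻ s in Ioo 0 t, ENNReal.ofReal (s⁻¹ * expLog (T / s) ^ (-(1 + 1 / 2) : ℝ))) +
        ENNReal.ofReal (2 / t * expLog (T / t) ^ (-(1 / 2) : ℝ)) *
          ENNReal.ofReal (t / (-a + 1)) := by
      rw [lintegral_add_right _ hmeas, lintegral_const_mul' _ _ ENNReal.ofReal_ne_top,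
        lintegral_const_mul' _ _ ENNReal.ofReal_ne_top,
        lintegral_Ioo_one_sub_div_rpow (by linarith) ht]
    _ ≤ ENNReal.ofReal 2 * ENNReal.ofReal ((1 + Real.exp 1) / (1 / 2) *
          expLog (T / t) ^ (-(1 / 2) : ℝ)) +
        ENNReal.ofReal (2 / t * expLog (T / t) ^ (-(1 / 2) : ℝ)) *
          ENNReal.ofReal (t / (-a + 1)) := by
      gcongr
      exact lintegral_inv_mul_expLog_le (by norm_num) ht htT.le
    _ = _ := by
      rw [← ENNReal.ofReal_mul two_pos.le, ← ENNReal.ofReal_mul (by positivity),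
        ← ENNReal.ofReal_add (by positivity) (by positivity)]
      congr 1
      field_simp

/-- The heat flow of the singular profile at the length scale `√T`. -/
noncomputable def logFlow (N : ℕ) (m T : ℝ) (z x : EuclideanSpace ℝ (Fin N)) (t : ℝ) : ENNReal :=
  ∫⁻ y, ENNReal.ofReal (heatKernel N (x - y) t) *
    ENNReal.ofReal (logProfile N m (Real.sqrt T) z y)

lemma toReal_logFlow_le {N : ℕ} {m C T t : ℝ} (hC : 0 ≤ C) (ht : 0 < t) (htT : t < T)
    {x z : EuclideanSpace ℝ (Fin N)}
    (h : logFlow N m T z x t ≤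
      ENNReal.ofReal (C * ((T / t) ^ ((N : ℝ) / 2) * expLog (T / t) ^ (-m)))) :
    (logFlow N m T z x t).toReal ≤ C * ((T / t) ^ ((N : ℝ) / 2) * expLog (T / t) ^ (-m)) := by
  have hX : 0 ≤ T / t := by
    have := ht.trans htT
    positivity
  have hE := expLog_pos hX
  exact (ENNReal.toReal_mono ENNReal.ofReal_ne_top h).trans_eq
    (ENNReal.toReal_ofReal (by positivity))

lemma rpow_parabolic_scaling {n q g T s t : ℝ} (hT : 0 < T) (hs : 0 < s) (hst : s < t)
    (hn : n * q = 1 - g / 2) :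
    (T ^ (-n)) ^ (1 + q) * (T / s) ^ (n * q) * (s * (t - s) / t) ^ (-g / 2) =
      T ^ (-n) * s⁻¹ * (1 - s / t) ^ (-(g / 2)) := by
  have ht : 0 < t := hs.trans hst
  have h1 : 0 ≤ 1 - s / t := sub_nonneg.2 ((div_le_one ht).2 hst.le)
  have h2 : s * (t - s) / t = s * (1 - s / t) := by field_simp
  rw [h2, Real.mul_rpow hs.le h1, Real.rpow_add (Real.rpow_pos_of_pos hT _), Real.rpow_one,
    ← Real.rpow_mul hT.le, Real.div_rpow hT.le hs.le, neg_mul, hn, Real.rpow_neg hT.le (1 - g / 2),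
    neg_div]
  have h3 : s⁻¹ = (s ^ (1 - g / 2))⁻¹ * s ^ (-(g / 2)) := by
    rw [← Real.rpow_neg hs.le, ← Real.rpow_add hs, ← Real.rpow_neg_one]
    ring_nf
  have hT' : T ^ (1 - g / 2) ≠ 0 := (Real.rpow_pos_of_pos hT _).ne'
  rw [h3]
  field_simp

/-- The Duhamel term of the damped heat flow is dominated by the damped heat flow. -/
lemma exists_lintegral_duhamel_logFlow_le {N : ℕ} (hN : 1 ≤ N) {γ q : ℝ} (hγ0 : 0 < γ)
    (hγ2 : γ < 2) (hγN : γ < N) (hq : q = (2 - γ) / N) :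
    ∃ A : ℝ, 0 < A ∧ ∀ (T B : ℝ) (z : EuclideanSpace ℝ (Fin N)), 0 ≤ B → ∀ x, ∀ t ∈ Ioo 0 T,
      ∫⁻ s in Ioo 0 t, ∫⁻ y,
        ENNReal.ofReal (heatKernel N (x - y) (t - s)) * ENNReal.ofReal (‖y‖ ^ (-γ)) *
          ENNReal.ofReal (B * (T ^ (-((N : ℝ) / 2)) *
            logDamp (logFlow N (1 / q - 1 / 2) T z y s).toReal)) ^ (1 + q) ≤
      ENNReal.ofReal (A * B ^ (1 + q) * (T ^ (-((N : ℝ) / 2)) *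
        logDamp (logFlow N (1 / q - 1 / 2) T z x t).toReal)) := by
  have hN0 : (0 : ℝ) < N := by exact_mod_cast hN
  have hN1 : (1 : ℝ) ≤ N := by exact_mod_cast hN
  have hq0 : 0 < q := by
    rw [hq]
    exact div_pos (by linarith) hN0
  have hq2 : q < 2 := by
    rw [hq, div_lt_iff₀ hN0]
    linarith
  have hnq : (N : ℝ) / 2 * q = 1 - γ / 2 := by
    rw [hq]
    field_simp
  have hm : 0 < 1 / q - 1 / 2 := sub_pos.2 (one_div_lt_one_div_of_lt hq0 hq2)
  have hγ1 : 0 < -(γ / 2) + 1 := by linarith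
  obtain ⟨C, hC, HC⟩ := exists_lintegral_heatKernel_mul_norm_rpow_le hN hγ0 hγN
  obtain ⟨C₁, hC₁, HC₁⟩ := exists_lintegral_heatKernel_logProfile_le hN hm
  obtain ⟨A₁, hA₁, HA₁⟩ := exists_logDamp_rpow_le (n := (N : ℝ) / 2) hC₁ (by positivity) hq0 hq2
  have hlog : 0 ≤ Real.log (1 + C₁) := Real.log_nonneg (by linarith)
  set K := 2 * ((1 + Real.exp 1) / (1 / 2)) + 2 / (-(γ / 2) + 1)
  set D := (1 + Real.log (1 + C₁)) * ((N : ℝ) / 2 + 2)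
  have hK0 : 0 < K := by positivity
  have hD0 : 0 < D := by positivity
  set m := 1 / q - 1 / 2 with hm_def
  refine ⟨A₁ * C * K * D ^ (1 / 2 : ℝ), by positivity, fun T B z hB x t ht => ?_⟩
  obtain ⟨ht0, htT⟩ := ht
  have hT : 0 < T := ht0.trans htT
  set a := T ^ (-((N : ℝ) / 2)) with ha
  have ha0 : 0 < a := Real.rpow_pos_of_pos hT _
  have hle : ∀ y, ∀ s ∈ Ioo 0 T, logFlow N m T z y s ≤
      ENNReal.ofReal (C₁ * ((T / s) ^ ((N : ℝ) / 2) * expLog (T / s) ^ (-m))) :=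
    fun y s hs => HC₁ T s hs.1 hs.2 y z
  have htop : ∀ y, ∀ s ∈ Ioo 0 T, logFlow N m T z y s ≠ ⊤ := fun y s hs =>
    ne_top_of_le_ne_top ENNReal.ofReal_ne_top (hle y s hs)
  have hsource : ∀ s ∈ Ioo 0 t, ∫⁻ y,
        ENNReal.ofReal (heatKernel N (x - y) (t - s)) * ENNReal.ofReal (‖y‖ ^ (-γ)) *
          ENNReal.ofReal (B * (a * logDamp (logFlow N m T z y s).toReal)) ^ (1 + q) ≤
      ENNReal.ofReal (B ^ (1 + q) * a * A₁ * C) * logFlow N m T z x t *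
        ENNReal.ofReal (s⁻¹ * expLog (T / s) ^ (-(1 + 1 / 2) : ℝ) *
          (1 - s / t) ^ (-(γ / 2))) := fun s hs => by
    have hs0 : 0 < s := hs.1
    have hsT : s < T := hs.2.trans htT
    have hX1 : 1 ≤ T / s := (one_le_div hs0).2 hsT.le
    have hEX := expLog_pos (x := T / s) (by positivity)
    set k := B ^ (1 + q) * a ^ (1 + q) *
      (A₁ * ((T / s) ^ ((N : ℝ) / 2 * q) * expLog (T / s) ^ (-(1 + 1 / 2) : ℝ))) with hk
    have hk0 : 0 ≤ k := by positivity
    have hpt : ∀ y, ENNReal.ofReal (B * (a * logDamp (logFlow N m T z y s).toReal)) ^ (1 + q) ≤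
        ENNReal.ofReal k * logFlow N m T z y s := fun y => by
      have hw : 0 ≤ (logFlow N m T z y s).toReal := ENNReal.toReal_nonneg
      have hL := logDamp_nonneg hw
      rw [ENNReal.ofReal_rpow_of_nonneg (by positivity) (by positivity)]
      conv_rhs => rw [← ENNReal.ofReal_toReal (htop y s ⟨hs0, hsT⟩)]
      rw [← ENNReal.ofReal_mul hk0, Real.mul_rpow hB (by positivity), Real.mul_rpow ha0.le hL]
      refine ENNReal.ofReal_le_ofReal ?_
      have h1 := HA₁ (T / s) _ hX1 hw (toReal_logFlow_le hC₁.le hs0 hsT (hle y s ⟨hs0, hsT⟩))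
      calc _ ≤ B ^ (1 + q) * (a ^ (1 + q) * (A₁ * ((T / s) ^ ((N : ℝ) / 2 * q) *
            expLog (T / s) ^ (-(1 + 1 / 2) : ℝ)) * (logFlow N m T z y s).toReal)) := by gcongr
        _ = _ := by rw [hk]; ring
    calc _ ≤ ∫⁻ y, ENNReal.ofReal k *
          (ENNReal.ofReal (heatKernel N (x - y) (t - s)) * ENNReal.ofReal (‖y‖ ^ (-γ)) *
            logFlow N m T z y s) := lintegral_mono fun y => by
          calc _ ≤ ENNReal.ofReal (heatKernel N (x - y) (t - s)) * ENNReal.ofReal (‖y‖ ^ (-γ)) *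
                (ENNReal.ofReal k * logFlow N m T z y s) := by gcongr; exact hpt y
            _ = _ := by ring
      _ ≤ ENNReal.ofReal k * (ENNReal.ofReal (C * (s * (t - s) / t) ^ (-γ / 2)) *
            logFlow N m T z x t) := by
          rw [lintegral_const_mul' _ _ ENNReal.ofReal_ne_top]
          gcongr
          exact lintegral_heatKernel_mul_norm_rpow_mul_le HC
            (measurable_logProfile N m (Real.sqrt T) z).ennreal_ofReal hs0 hs.2 x
      _ = ENNReal.ofReal (k * (C * (s * (t - s) / t) ^ (-γ / 2))) * logFlow N m T z x t := by
          rw [ENNReal.ofReal_mul hk0, mul_assoc]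
      _ = _ := by
          have h1 : 0 ≤ B ^ (1 + q) * a * A₁ * C := by positivity
          rw [mul_right_comm (ENNReal.ofReal _), ← ENNReal.ofReal_mul h1]
          congr 2
          have h2 := rpow_parabolic_scaling (g := γ) hT hs0 hs.2 hnq
          rw [← ha] at h2
          rw [hk]
          linear_combination
            (B ^ (1 + q) * A₁ * C * expLog (T / s) ^ (-(1 + 1 / 2) : ℝ)) * h2
  set w := (logFlow N m T z x t).toReal with hw_def
  have hw : 0 ≤ w := ENNReal.toReal_nonneg
  have hX : 0 ≤ T / t := by positivity
  have hEX := expLog_pos hX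
  have hdamp : expLog (T / t) ^ (-(1 / 2) : ℝ) ≤ D ^ (1 / 2 : ℝ) * expLog w ^ (-(1 / 2) : ℝ) := by
    refine expLog_rpow_neg_le hw hX hD0 (by norm_num)
      (expLog_le_of_le_mul_rpow hC₁.le (by positivity) hX hw ?_)
    refine (toReal_logFlow_le hC₁.le ht0 htT (hle x t ⟨ht0, htT⟩)).trans ?_
    gcongr
    exact mul_le_of_le_one_right (by positivity)
      (Real.rpow_le_one_of_one_le_of_nonpos (one_le_expLog hX) (by linarith))
  have hWtop := htop x t ⟨ht0, htT⟩
  calc _ ≤ ∫⁻ s in Ioo 0 t, ENNReal.ofReal (B ^ (1 + q) * a * A₁ * C) * logFlow N m T z x t *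
        ENNReal.ofReal (s⁻¹ * expLog (T / s) ^ (-(1 + 1 / 2) : ℝ) *
          (1 - s / t) ^ (-(γ / 2))) := setLIntegral_mono' measurableSet_Ioo hsource
    _ ≤ ENNReal.ofReal (B ^ (1 + q) * a * A₁ * C) * logFlow N m T z x t *
        ENNReal.ofReal (K * (D ^ (1 / 2 : ℝ) * expLog w ^ (-(1 / 2) : ℝ))) := by
        rw [lintegral_const_mul' _ _ (ENNReal.mul_ne_top ENNReal.ofReal_ne_top hWtop)]
        gcongr
        refine (lintegral_time_le (by positivity) (by linarith) ht0 htT).trans ?_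
        gcongr
    _ = _ := by
        rw [← ENNReal.ofReal_toReal hWtop, ← hw_def, ← ENNReal.ofReal_mul (by positivity),
          ← ENNReal.ofReal_mul (by positivity)]
        congr 1
        rw [logDamp]
        ring

/-- Jensen-type estimate for the heat flow of the damped profile. -/
lemma exists_lintegral_heatKernel_logDamp_le {N : ℕ} (hN : 1 ≤ N) {m : ℝ} (hm : 0 < m) :
    ∃ A : ℝ, 0 < A ∧ ∀ (T : ℝ) (z : EuclideanSpace ℝ (Fin N)) (ε : ℝ)
      (u₀ : EuclideanSpace ℝ (Fin N) → ℝ), 0 ≤ ε →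
      (∀ y, y ≠ z → u₀ y ≤ ε * logDamp (logProfile N m (Real.sqrt T) z y)) →
      ∀ x, ∀ t ∈ Ioo 0 T,
        ∫⁻ y, ENNReal.ofReal (heatKernel N (x - y) t) * ENNReal.ofReal (u₀ y) ≤
          ENNReal.ofReal (A * ε * logDamp (logFlow N m T z x t).toReal) := by
  obtain ⟨C₁, hC₁, HC₁⟩ := exists_lintegral_heatKernel_logProfile_le hN hm
  obtain ⟨A, hA, HA⟩ := exists_logDamp_le_mul_add
  refine ⟨1 + A, by positivity, fun T z ε u₀ hε hu₀ x t ht => ?_⟩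
  have : Nonempty (Fin N) := Fin.pos_iff_nonempty.1 hN
  have htop : logFlow N m T z x t ≠ ⊤ :=
    ne_top_of_le_ne_top ENNReal.ofReal_ne_top (HC₁ T t ht.1 ht.2 x z)
  set w := (logFlow N m T z x t).toReal with hw_def
  have hw : 0 ≤ w := ENNReal.toReal_nonneg
  set E := expLog w ^ (-(1 / 2) : ℝ) with hE
  have hE0 : 0 ≤ E := Real.rpow_nonneg (expLog_pos hw).le _
  have hmk : Measurable fun y => ENNReal.ofReal (heatKernel N (x - y) t) :=
    (measurable_heatKernel_comp (by fun_prop) (by fun_prop)).ennreal_ofReal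
  have hae : ∀ᵐ y : EuclideanSpace ℝ (Fin N), y ≠ z := by
    rw [ae_iff]
    simp
  have hpt : ∀ᵐ y : EuclideanSpace ℝ (Fin N),
      ENNReal.ofReal (heatKernel N (x - y) t) * ENNReal.ofReal (u₀ y) ≤
        ENNReal.ofReal (ε * E) * (ENNReal.ofReal (heatKernel N (x - y) t) *
          ENNReal.ofReal (logProfile N m (Real.sqrt T) z y) +
          ENNReal.ofReal (heatKernel N (x - y) t) * ENNReal.ofReal (A * w)) := by
    filter_upwards [hae] with y hy
    have h0 : 0 ≤ logProfile N m (Real.sqrt T) z y :=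
      zero_le_one.trans (one_le_logProfile (Real.sqrt_nonneg T) z y)
    calc _ ≤ ENNReal.ofReal (heatKernel N (x - y) t) *
          ENNReal.ofReal (ε * E * (logProfile N m (Real.sqrt T) z y + A * w)) := by
          gcongr
          refine (hu₀ y hy).trans ?_
          rw [mul_assoc]
          gcongr
          exact HA _ _ h0 hw
      _ = _ := by
          rw [ENNReal.ofReal_mul (by positivity), ENNReal.ofReal_add h0 (by positivity)]
          ring
  calc _ ≤ _ := lintegral_mono_ae hpt
    _ = ENNReal.ofReal (ε * E) * (logFlow N m T z x t + ENNReal.ofReal (A * w)) := by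
        rw [lintegral_const_mul' _ _ ENNReal.ofReal_ne_top,
          lintegral_add_right _ (hmk.mul_const _), lintegral_mul_const _ hmk,
          lintegral_heatKernel N x ht.1, one_mul, logFlow]
    _ = _ := by
        rw [← ENNReal.ofReal_toReal htop, ← hw_def, ← ENNReal.ofReal_add hw (by positivity),
          ← ENNReal.ofReal_mul (by positivity)]
        congr 1
        rw [logDamp]
        ring

/-- The admissible initial data are dominated by the damped profile at the length scale `√T`. -/
lemma exists_initial_le_logDamp {N : ℕ} (hN : 1 ≤ N) {q : ℝ} (hq : 0 < q) (hq2 : q < 2) :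
    ∃ A : ℝ, 0 < A ∧ ∀ (T : ℝ) (y z : EuclideanSpace ℝ (Fin N)) (κ c C₀ : ℝ), 0 < T → y ≠ z →
      0 < κ → 0 ≤ c → c ≤ κ * (1 + Real.sqrt T) ^ (-(1 / q)) →
      C₀ ≤ κ * T ^ (-((N : ℝ) / 2)) →
      c * (‖y - z‖ ^ (-(N : ℝ)) * expLog ‖y - z‖⁻¹ ^ (-(1 / q + 1))) + C₀ ≤
        A * κ * T ^ (-((N : ℝ) / 2)) *
          logDamp (logProfile N (1 / q - 1 / 2) (Real.sqrt T) z y) := by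
  have hN0 : (0 : ℝ) < N := by exact_mod_cast hN
  have hm : 0 < 1 / q - 1 / 2 := sub_pos.2 (one_div_lt_one_div_of_lt hq hq2)
  have hq' : 0 < 1 / q := by positivity
  obtain ⟨A₁, hA₁, H₁⟩ := exists_one_add_log_rpow_le (a := 1 / q) (m := 1 / q + 1) hq'
    (by positivity)
  obtain ⟨A₂, hA₂, H₂⟩ := exists_le_logDamp N hN0 (1 + (1 / q - 1 / 2)) (by positivity)
  refine ⟨A₁ * A₂ + A₂, by positivity, fun T y z κ c C₀ hT hyz hκ hc hcκ hC₀ => ?_⟩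
  have hr : 0 < ‖y - z‖ := norm_pos_iff.2 (sub_ne_zero.2 hyz)
  set r := ‖y - z‖ with hr_def
  have hτ : 0 < Real.sqrt T := Real.sqrt_pos.2 hT
  set τ := Real.sqrt T with hτ_def
  set a := T ^ (-((N : ℝ) / 2)) with ha_def
  have ha0 : 0 < a := Real.rpow_pos_of_pos hT _
  have hY : 0 ≤ τ / r := by positivity
  have hEY := expLog_pos hY
  have hEr := expLog_pos (inv_nonneg.2 hr.le)
  set L := logDamp (logProfile N (1 / q - 1 / 2) τ z y) with hL
  obtain ⟨h1, h2⟩ := H₂ (τ / r) hY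
  have e1 : 1 + (1 / q - 1 / 2) + 1 / 2 = 1 / q + 1 := by ring
  rw [e1] at h1
  have h1' : (τ / r) ^ (N : ℝ) * expLog (τ / r) ^ (-(1 / q + 1)) ≤ A₂ * L := h1
  have h2' : 1 ≤ A₂ * L := h2
  have hlog : 0 ≤ Real.log (1 + τ) := Real.log_nonneg (by linarith)
  have h3 : expLog r⁻¹ ^ (-(1 / q + 1)) ≤
      (1 + Real.log (1 + τ)) ^ (1 / q + 1) * expLog (τ / r) ^ (-(1 / q + 1)) := by
    refine expLog_rpow_neg_le hY (inv_nonneg.2 hr.le) (by positivity) (by positivity) ?_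
    exact expLog_mul_le hτ.le (inv_nonneg.2 hr.le)
  have h4 : r ^ (-(N : ℝ)) = a * (τ / r) ^ (N : ℝ) := by
    rw [Real.div_rpow hτ.le hr.le, hτ_def, Real.sqrt_eq_rpow, ← Real.rpow_mul hT.le, ha_def,
      mul_div_assoc', ← Real.rpow_add hT, Real.rpow_neg hr.le]
    ring_nf
    simp
  have h5 : c * (1 + Real.log (1 + τ)) ^ (1 / q + 1) ≤ κ * A₁ := by
    calc _ ≤ κ * (1 + τ) ^ (-(1 / q)) * (A₁ * (1 + τ) ^ (1 / q)) := by
          gcongr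
          exact H₁ τ hτ.le
      _ = κ * A₁ * ((1 + τ) ^ (-(1 / q)) * (1 + τ) ^ (1 / q)) := by ring
      _ = _ := by rw [← Real.rpow_add (by positivity), neg_add_cancel, Real.rpow_zero, mul_one]
  calc _ ≤ c * (a * (τ / r) ^ (N : ℝ) * ((1 + Real.log (1 + τ)) ^ (1 / q + 1) *
        expLog (τ / r) ^ (-(1 / q + 1)))) + κ * a := by
        rw [h4]
        gcongr
    _ = (c * (1 + Real.log (1 + τ)) ^ (1 / q + 1)) * a *
        ((τ / r) ^ (N : ℝ) * expLog (τ / r) ^ (-(1 / q + 1))) + κ * a * 1 := by ring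
    _ ≤ (κ * A₁) * a * (A₂ * L) + κ * a * (A₂ * L) := by
        gcongr
    _ = _ := by ring

theorem statement6 (N : ℕ) (hN : 1 ≤ N) (γ p : ℝ)
    (hγ0 : 0 < γ) (hγ : γ < min 2 (N : ℝ)) (hp : p = 1 + (2 - γ) / (N : ℝ)) :
    ∃ cstar Cstar : ℝ, 0 < cstar ∧ 0 < Cstar ∧
      ∀ (T : ℝ), 0 < T →
      ∀ (z : EuclideanSpace ℝ (Fin N)),
      ∀ (u₀ : EuclideanSpace ℝ (Fin N) → ℝ) (c C₀ : ℝ),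
        Measurable u₀ → (∀ x, 0 ≤ u₀ x) →
        0 < c → c ≤ cstar * (1 + T ^ ((1 : ℝ) / 2)) ^ (-1 / (p - 1)) →
        0 ≤ C₀ → C₀ ≤ Cstar * T ^ (-(2 - γ) / (2 * (p - 1))) →
        (∀ x, x ≠ z →
          u₀ x ≤ c *
              (‖x - z‖ ^ (-(N : ℝ)) *
                Real.log (Real.exp 1 + ‖x - z‖⁻¹) ^ (-(N : ℝ) / (2 - γ) - 1) *
                Set.indicator (Set.Icc (0 : ℝ) 1) (fun _ => (1 : ℝ)) ‖x - z‖) + C₀) →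
        ∃ u, IsSol N γ p T u₀ u := by
  have hN0 : (0 : ℝ) < N := by exact_mod_cast hN
  have hN1 : (1 : ℝ) ≤ N := by exact_mod_cast hN
  obtain ⟨hγ2, hγN⟩ := lt_min_iff.1 hγ
  have h2γ : 0 < 2 - γ := by linarith
  set q := (2 - γ) / (N : ℝ) with hq
  have hq0 : 0 < q := div_pos h2γ hN0
  have hq2 : q < 2 := by
    rw [hq, div_lt_iff₀ hN0]
    linarith
  have hm : 0 < 1 / q - 1 / 2 := sub_pos.2 (one_div_lt_one_div_of_lt hq0 hq2)
  obtain ⟨A₁, hA₁, H₁⟩ := exists_lintegral_duhamel_logFlow_le hN hγ0 hγ2 hγN hq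
  obtain ⟨A₂, hA₂, H₂⟩ := exists_lintegral_heatKernel_logDamp_le hN hm
  obtain ⟨A₃, hA₃, H₃⟩ := exists_initial_le_logDamp hN hq0 hq2
  set B := (1 / (2 * A₁)) ^ (1 / q) with hB
  have hB0 : 0 < B := by positivity
  have hBq : A₁ * B ^ (1 + q) = B / 2 := by
    rw [Real.rpow_add hB0, Real.rpow_one, hB, ← Real.rpow_mul (by positivity),
      one_div_mul_cancel hq0.ne', Real.rpow_one]
    field_simp
  set κ := B / (2 * A₂ * A₃) with hκ
  have hκ0 : 0 < κ := by positivity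
  have hκB : A₂ * (A₃ * κ) = B / 2 := by
    rw [hκ]
    field_simp
  have e1 : -1 / (p - 1) = -(1 / q) := by rw [hp]; ring
  have e2 : -(2 - γ) / (2 * (p - 1)) = -((N : ℝ) / 2) := by
    have h : 2 - γ = q * N := (div_mul_cancel₀ _ hN0.ne').symm
    rw [hp, add_sub_cancel_left, h]
    field_simp
  have e3 : -(N : ℝ) / (2 - γ) - 1 = -(1 / q + 1) := by
    rw [hq]
    field_simp
    ring
  refine ⟨κ, κ, hκ0, hκ0, fun T hT z u₀ c C₀ hu₀ hu₀' hc hcκ _ hC₀κ hle => ?_⟩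
  rw [e1, ← Real.sqrt_eq_rpow] at hcκ
  rw [e2] at hC₀κ
  set a := T ^ (-((N : ℝ) / 2)) with ha
  have ha0 : 0 < a := Real.rpow_pos_of_pos hT _
  have hdata : ∀ y, y ≠ z → u₀ y ≤
      A₃ * κ * a * logDamp (logProfile N (1 / q - 1 / 2) (Real.sqrt T) z y) := fun y hy => by
    refine le_trans ?_ (H₃ T y z κ c C₀ hT hy hκ0 hc.le hcκ hC₀κ)
    have hE := expLog_pos (x := ‖y - z‖⁻¹) (by positivity)
    refine (hle y hy).trans ?_
    rw [e3]
    refine add_le_add (mul_le_mul_of_nonneg_left ?_ hc.le) le_rfl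
    exact mul_le_of_le_one_right (by positivity)
      (indicator_le_self' (f := fun _ : ℝ => (1 : ℝ)) (fun _ _ => zero_le_one) ‖y - z‖)
  refine exists_isSol_of_mildOp_le (by rw [hp]; positivity) hu₀ hu₀'
    (V := fun x t => ENNReal.ofReal
      (B * (a * logDamp (logFlow N (1 / q - 1 / 2) T z x t).toReal)))
    (fun _ _ _ => ENNReal.ofReal_ne_top) fun x t ht => ?_
  have hL := logDamp_nonneg (w := (logFlow N (1 / q - 1 / 2) T z x t).toReal)
    ENNReal.toReal_nonneg
  rw [mildOp, hp]
  refine (add_le_add (H₂ T z _ u₀ (by positivity) hdata x t ht)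
    (H₁ T B z hB0.le x t ht)).trans_eq ?_
  rw [← ENNReal.ofReal_add (by positivity) (by positivity), hBq]
  congr 1
  linear_combination
    (a * logDamp (logFlow N (1 / q - 1 / 2) T z x t).toReal) * hκB
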